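/- arXiv:math/0502194 — 3 statements merged into one kernel-verified Lean document; each statement's English description precedes it below -/
import Mathlib

section
/- Let p and l be primes with p dividing l − 1, and α an integer whose class in F_l is not a p-th power. If K/Q_l is a finite field extension of degree prime to p, then the equation x_1^p + l·x_2^p + ... + l^{p−1}·x_p^p = α·x_0^p has no nontrivial solution in K. -/
section Helpers

variable {l : ℕ} [Fact l.Prime] {K : Type} [Field K] [Algebra ℚ_[l] K]
  [FiniteDimensional ℚ_[l] K]

lemma aux_conj (σ τ : K →ₐ[ℚ_[l]] PadicAlgCl l) (y : K) : ‖σ y‖ = ‖τ y‖ := by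
  rw [← PadicAlgCl.spectralNorm_eq, ← PadicAlgCl.spectralNorm_eq, spectralNorm, spectralNorm,
    minpoly.algHom_eq σ σ.injective, minpoly.algHom_eq τ τ.injective]

lemma aux_norm (σ : K →ₐ[ℚ_[l]] PadicAlgCl l) (y : K) :
    ‖Algebra.norm ℚ_[l] y‖ = ‖σ y‖ ^ Module.finrank ℚ_[l] K := by
  rw [← PadicAlgCl.norm_extends, Algebra.norm_eq_prod_embeddings ℚ_[l] (PadicAlgCl l) y, norm_prod,
    Finset.prod_congr rfl (fun τ _ => aux_conj τ σ y), Finset.prod_const, Finset.card_univ,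
    AlgHom.card]

lemma aux_prod {L ι : Type*} [NormedField L] [IsUltrametricDist L] (s : Finset ι) (f : ι → L)
    (h : ∀ i ∈ s, ‖f i - 1‖ < 1) : ‖∏ i ∈ s, f i - 1‖ < 1 := by
  classical
  induction s using Finset.induction_on with
  | empty => simp
  | insert a s ha ih =>
    rw [Finset.prod_insert ha]
    have h1 := h a (Finset.mem_insert_self _ _)
    have h2 := ih (fun i hi => h i (Finset.mem_insert_of_mem hi))
    have h3 : ‖f a‖ ≤ 1 := by
      have := IsUltrametricDist.norm_add_le_max (f a - 1) 1
      simp only [sub_add_cancel, norm_one] at this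
      exact this.trans (max_le h1.le le_rfl)
    have e : f a * ∏ i ∈ s, f i - 1 = f a * (∏ i ∈ s, f i - 1) + (f a - 1) := by ring
    rw [e]
    refine (IsUltrametricDist.norm_add_le_max _ _).trans_lt (max_lt ?_ h1)
    rw [norm_mul]
    exact (mul_le_of_le_one_left (norm_nonneg _) h3).trans_lt h2

lemma aux_norm_one (σ : K →ₐ[ℚ_[l]] PadicAlgCl l) (y : K) (h : ‖σ (y - 1)‖ < 1) :
    ‖Algebra.norm ℚ_[l] y - 1‖ < 1 := by
  rw [← PadicAlgCl.norm_extends, map_sub, map_one,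
    Algebra.norm_eq_prod_embeddings ℚ_[l] (PadicAlgCl l) y]
  refine aux_prod _ _ fun τ _ => ?_
  rw [← map_one τ, ← map_sub, aux_conj τ σ]
  exact h

lemma aux_distinct (σ : K →ₐ[ℚ_[l]] PadicAlgCl l) {p : ℕ}
    (hK : Nat.Coprime (Module.finrank ℚ_[l] K) p) {i j : ℕ} (hi : i < p) (hj : j < p)
    {y z : K} (hy : y ≠ 0) (hz : z ≠ 0)
    (h : ‖σ ((l : K) ^ i * y ^ p)‖ = ‖σ ((l : K) ^ j * z ^ p)‖) : i = j := by
  have hl : (l : K) = algebraMap ℚ_[l] K l := by simp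
  have h' := congrArg (· ^ Module.finrank ℚ_[l] K) h
  simp only [← aux_norm] at h'
  simp only [map_mul, map_pow, hl, Algebra.norm_algebraMap, norm_mul, norm_pow,
    Padic.norm_p] at h'
  have hl1 : (1 : ℝ) < l := by exact_mod_cast (Fact.out : l.Prime).one_lt
  have hl0 : (l : ℝ) ≠ 0 := by positivity
  rw [Padic.norm_eq_zpow_neg_valuation (Algebra.norm_ne_zero_iff.2 hy),
    Padic.norm_eq_zpow_neg_valuation (Algebra.norm_ne_zero_iff.2 hz)] at h'
  simp only [← zpow_natCast, ← zpow_neg_one, ← zpow_mul, ← zpow_add₀ hl0] at h'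
  have h2 := zpow_right_injective₀ (by linarith) hl1.ne' h'
  have h3 : (p : ℤ) ∣ (Module.finrank ℚ_[l] K : ℤ) * ((i : ℤ) - j) :=
    ⟨(Algebra.norm ℚ_[l] z).valuation - (Algebra.norm ℚ_[l] y).valuation, by linarith⟩
  have h4 : (p : ℤ) ∣ (i : ℤ) - j :=
    IsCoprime.dvd_of_dvd_mul_left (Nat.isCoprime_iff_coprime.2 hK.symm) h3
  have h5 := Int.eq_zero_of_abs_lt_dvd h4 (by rw [abs_lt]; omega)
  omega

end Helpers

lemma aux_pow {F : Type*} [Field F] {a c : F} {n p : ℕ} (h : Nat.Coprime n p) (ha : a ≠ 0)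
    (hc : c ≠ 0) (hac : c ^ p = a ^ n) : ∃ b : F, b ^ p = a := by
  obtain ⟨u, v, huv⟩ := Nat.isCoprime_iff_coprime.2 h
  refine ⟨c ^ u * a ^ v, ?_⟩
  have hac' : c ^ (p : ℤ) = a ^ (n : ℤ) := by simpa using hac
  rw [← zpow_natCast, mul_zpow, ← zpow_mul, ← zpow_mul, mul_comm u, zpow_mul, hac', ← zpow_mul,
    ← zpow_add₀ ha]
  rw [show (n : ℤ) * u + v * p = 1 by linarith, zpow_one]

/-- If `p, l` are primes with `p ∣ l - 1`, `α` an integer whose class mod `l` is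
not a `p`-th power, and `K/ℚ_[l]` is a finite extension of degree prime to `p`, then the
equation `x 1 ^ p + l * x 2 ^ p + ⋯ + l ^ (p-1) * x p ^ p = α * x 0 ^ p` has no nontrivial
solution in `K`. -/
theorem stmt_1 (p l : ℕ) [Fact p.Prime] [Fact l.Prime] (hdvd : p ∣ l - 1)
    (α : ℤ) (hα : ¬ ∃ b : ZMod l, b ^ p = (α : ZMod l))
    (K : Type) [Field K] [Algebra ℚ_[l] K] [FiniteDimensional ℚ_[l] K]
    (hK : Nat.Coprime (Module.finrank ℚ_[l] K) p)
    (x : Fin (p + 1) → K)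
    (hx : ∑ i : Fin p, (l : K) ^ (i : ℕ) * x i.succ ^ p = (α : K) * x 0 ^ p) :
    x = 0 := by
  have hp : p.Prime := Fact.out
  have hα0 : (α : ZMod l) ≠ 0 := fun h => hα ⟨0, by rw [h, zero_pow hp.ne_zero]⟩
  have hαn : ‖(α : ℚ_[l])‖ = 1 := by
    refine le_antisymm (Padic.norm_int_le_one α) (not_lt.1 fun h => hα0 ?_)
    rw [ZMod.intCast_zmod_eq_zero_iff_dvd]
    exact (PadicInt.norm_int_lt_one_iff_dvd α).1 (by rw [PadicInt.norm_def]; push_cast; exact h)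
  have hαQ : (α : ℚ_[l]) ≠ 0 := fun h => by simp [h] at hαn
  have hαm : (α : K) = algebraMap ℚ_[l] K α := by simp
  have hαK : (α : K) ≠ 0 := by rw [hαm]; exact (map_ne_zero _).2 hαQ
  have hlK : (l : K) ≠ 0 := by
    rw [show (l : K) = algebraMap ℚ_[l] K l by simp]
    exact (map_ne_zero _).2 (Nat.cast_ne_zero.2 (Fact.out : l.Prime).ne_zero)
  let σ : K →ₐ[ℚ_[l]] PadicAlgCl l := IsAlgClosed.lift
  have hσα : ‖σ (α : K)‖ = 1 := by
    rw [hαm, AlgHom.commutes, PadicAlgCl.norm_extends, hαn]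
  by_contra hx0
  let t : Fin p → K := fun i => (l : K) ^ (i : ℕ) * x i.succ ^ p
  have ht0 : ∀ i, t i = 0 → x i.succ = 0 := fun i h =>
    (pow_eq_zero_iff hp.ne_zero).1 ((mul_eq_zero.1 h).resolve_left (pow_ne_zero _ hlK))
  obtain ⟨i0, -, hmax⟩ := Finset.exists_max_image (Finset.univ : Finset (Fin p)) (fun i => ‖σ (t i)‖)
    ⟨⟨0, hp.pos⟩, Finset.mem_univ _⟩
  have hpos : t i0 ≠ 0 := by
    intro h
    have hall : ∀ i, t i = 0 := fun i => by
      have := hmax i (Finset.mem_univ _)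
      rw [h, map_zero, norm_zero, norm_le_zero_iff] at this
      exact (map_eq_zero σ).1 this
    apply hx0
    have h0 : x 0 = 0 := by
      have : ∑ i, t i = (α : K) * x 0 ^ p := hx
      rw [Finset.sum_eq_zero (fun i _ => hall i)] at this
      exact (pow_eq_zero_iff hp.ne_zero).1 ((mul_eq_zero.1 this.symm).resolve_left hαK)
    funext i
    refine Fin.cases h0 (fun i => ht0 i (hall i)) i
  have hM : 0 < ‖σ (t i0)‖ := norm_pos_iff.2 ((map_ne_zero σ).2 hpos)
  have hxi : x i0.succ ≠ 0 := fun h => hpos (by simp [t, h, hp.ne_zero])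
  have hlt : ∀ i ∈ Finset.univ.erase i0, ‖σ (t i)‖ < ‖σ (t i0)‖ := by
    intro i hi
    refine lt_of_le_of_ne (hmax i (Finset.mem_univ _)) fun he => Finset.ne_of_mem_erase hi ?_
    have hti : x i.succ ≠ 0 := fun h => by
      have : t i = 0 := by simp [t, h, hp.ne_zero]
      rw [← he, this, map_zero, norm_zero] at hM
      exact lt_irrefl _ hM
    exact Fin.ext (aux_distinct σ hK i.2 i0.2 hti hxi he)
  have hrest : ‖∑ i ∈ Finset.univ.erase i0, σ (t i)‖ < ‖σ (t i0)‖ := by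
    rcases (Finset.univ.erase i0).eq_empty_or_nonempty with h | h
    · rw [h]; simpa using hM
    · obtain ⟨i, hi, hle⟩ := IsUltrametricDist.exists_norm_finsetSum_le_of_nonempty h
        (fun i => σ (t i))
      exact hle.trans_lt (hlt i hi)
  have hsum : σ (t i0) + ∑ i ∈ Finset.univ.erase i0, σ (t i) = σ ((α : K) * x 0 ^ p) := by
    rw [Finset.add_sum_erase _ (fun i => σ (t i)) (Finset.mem_univ _), ← map_sum]
    exact congrArg σ hx
  have hnorm : ‖σ ((α : K) * x 0 ^ p)‖ = ‖σ (t i0)‖ := by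
    rw [← hsum, IsUltrametricDist.norm_add_eq_max_of_norm_ne_norm hrest.ne', max_eq_left hrest.le]
  have hx00 : x 0 ≠ 0 := fun h => by
    rw [← hnorm, h, zero_pow hp.ne_zero, mul_zero, map_zero, norm_zero] at hM
    exact lt_irrefl _ hM
  have hi0 : (i0 : ℕ) = 0 := by
    refine aux_distinct σ hK i0.2 hp.pos hxi hx00 ?_
    change ‖σ (t i0)‖ = _
    rw [← hnorm, map_mul, norm_mul, hσα]
    simp
  have hti0 : t i0 = x i0.succ ^ p := by simp [t, hi0]
  set y : K := x i0.succ / x 0 with hy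
  have hy0 : y ≠ 0 := div_ne_zero hxi hx00
  have hD : (α : K) * x 0 ^ p ≠ 0 := mul_ne_zero hαK (pow_ne_zero _ hx00)
  have hone : ‖σ (y ^ p / (α : K) - 1)‖ < 1 := by
    have e : y ^ p / (α : K) - 1 = -(((α : K) * x 0 ^ p - t i0) / ((α : K) * x 0 ^ p)) := by
      rw [hti0, hy, div_pow]
      have := pow_ne_zero p hx00
      field_simp
      ring
    rw [e, map_neg, norm_neg, map_div₀, norm_div, hnorm, div_lt_one hM, map_sub, ← hsum,
      add_sub_cancel_left]
    exact hrest
  have hN := aux_norm_one σ _ hone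
  have hdiv : Algebra.norm ℚ_[l] (y ^ p / (α : K)) =
      (Algebra.norm ℚ_[l] y) ^ p / (α : ℚ_[l]) ^ (Module.finrank ℚ_[l] K) := by
    rw [eq_div_iff (pow_ne_zero _ hαQ), ← Algebra.norm_algebraMap, ← map_mul, ← hαm,
      div_mul_cancel₀ _ hαK, map_pow]
  rw [hdiv] at hN
  set c : ℚ_[l] := Algebra.norm ℚ_[l] y with hc
  set n := Module.finrank ℚ_[l] K with hn
  have hN' : ‖c ^ p - (α : ℚ_[l]) ^ n‖ < 1 := by
    have e : c ^ p - (α : ℚ_[l]) ^ n = (c ^ p / (α : ℚ_[l]) ^ n - 1) * (α : ℚ_[l]) ^ n := by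
      field_simp
    rw [e, norm_mul, norm_pow, hαn, one_pow, mul_one]
    exact hN
  have hcp : ‖c ^ p‖ = 1 := by
    have h1 : ‖(α : ℚ_[l]) ^ n‖ = 1 := by rw [norm_pow, hαn, one_pow]
    have := IsUltrametricDist.norm_add_eq_max_of_norm_ne_norm
      (x := c ^ p - (α : ℚ_[l]) ^ n) (y := (α : ℚ_[l]) ^ n) (by rw [h1]; exact hN'.ne)
    rw [sub_add_cancel, h1, max_eq_right hN'.le] at this
    exact this
  have hc1 : ‖c‖ = 1 := by
    rw [norm_pow] at hcp
    exact (pow_eq_one_iff_of_nonneg (norm_nonneg _) hp.ne_zero).1 hcp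
  let C : ℤ_[l] := ⟨c, hc1.le⟩
  have hker : ∀ z : ℤ_[l], PadicInt.toZMod z = 0 ↔ ‖z‖ < 1 := fun z => by
    rw [← RingHom.mem_ker, PadicInt.ker_toZMod, IsLocalRing.mem_maximalIdeal,
      PadicInt.mem_nonunits]
  have hCe : PadicInt.toZMod (C ^ p - (α : ℤ_[l]) ^ n) = 0 := by
    rw [hker, PadicInt.norm_def]
    push_cast
    exact hN'
  have hC0 : PadicInt.toZMod C ≠ 0 := fun h => by
    rw [hker, PadicInt.norm_def] at h
    exact h.ne hc1
  rw [map_sub, map_pow, map_pow, map_intCast, sub_eq_zero] at hCe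
  exact hα (aux_pow hK hα0 hC0 hCe)
end

section
/- Let p ≥ 5 and l be distinct primes with p ∣ (l−1), and α an integer not a p-th power mod l. Let X ⊂ P^p_Q be the hypersurface defined by x_1^p + l·x_2^p + ... + l^{p−1}·x_p^p − α·x_0^p = 0. Then the index I(X) of X over Q equals p. -/
open IntermediateField

/-- `X(K) ≠ ∅` for the projective hypersurface
`x 1 ^ p + l * x 2 ^ p + ⋯ + l ^ (p-1) * x p ^ p = α * x 0 ^ p`: there is a nonzero
solution with coordinates in `K`. -/
def HasPoint (p l : ℕ) (α : ℤ) (K : Type) [Field K] : Prop :=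
  ∃ x : Fin (p + 1) → K, x ≠ 0 ∧
    ∑ i : Fin p, (l : K) ^ (i : ℕ) * x i.succ ^ p = (α : K) * x 0 ^ p

/-- `g` is the index `I(X)` of the hypersurface over `ℚ`: the gcd of the degrees `[K : ℚ]`
over all finite extensions `K/ℚ` (inside a fixed algebraic closure) with `X(K) ≠ ∅`. -/
def IsIndex (p l : ℕ) (α : ℤ) (g : ℕ) : Prop :=
  (∀ K : IntermediateField ℚ (AlgebraicClosure ℚ), FiniteDimensional ℚ K →
      HasPoint p l α K → g ∣ Module.finrank ℚ K) ∧
  ∀ d : ℕ, (∀ K : IntermediateField ℚ (AlgebraicClosure ℚ), FiniteDimensional ℚ K →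
      HasPoint p l α K → d ∣ Module.finrank ℚ K) → d ∣ g

open Polynomial in
theorem aux_minpoly {F L : Type*} [Field F] [Field L] [Algebra F L]
    {p : ℕ} (hp : p.Prime) {a : F} (ha : ∀ b : F, b ^ p ≠ a) (b : L)
    (hb : b ^ p = algebraMap F L a) : minpoly F b = X ^ p - C a :=
  (minpoly.eq_of_irreducible_of_monic (X_pow_sub_C_irreducible_of_prime hp ha) (by simp [hb])
    (monic_X_pow_sub_C a hp.ne_zero)).symm

open Polynomial in
theorem aux_dvd_finrank {F L : Type*} [Field F] [Field L] [Algebra F L] [FiniteDimensional F L]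
    {p : ℕ} (hp : p.Prime) {a : F} (ha : ∀ b : F, b ^ p ≠ a) (b : L)
    (hb : b ^ p = algebraMap F L a) : p ∣ Module.finrank F L := by
  have h2 := aux_minpoly hp ha b hb
  have h3 : Module.finrank F F⟮b⟯ = p := by
    rw [IntermediateField.adjoin.finrank (IsIntegral.of_finite F b), h2, natDegree_X_pow_sub_C]
  rw [← Module.finrank_mul_finrank F F⟮b⟯ L, h3]
  exact dvd_mul_right _ _

theorem aux_val {K : Type} [Field K] (v : Valuation K (WithZero (Multiplicative ℤ)))
    (p l : ℕ) (hp : p.Prime) (α : ℤ) (e : ℕ) (he : ¬ p ∣ e)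
    (hl : v (l : K) = WithZero.exp (-(e : ℤ))) (hα : v (α : K) = 1) (h : HasPoint p l α K) :
    ∃ y : K, v y ≤ 1 ∧ v (y ^ p - α) < 1 := by
  obtain ⟨x, hx0, hx⟩ := h
  have hp0 := hp.pos
  have : NeZero p := ⟨hp.ne_zero⟩
  set f : Fin p → K := fun i => (l : K) ^ (i : ℕ) * x i.succ ^ p with hf
  have hlne : (l : K) ≠ 0 := by
    intro h0
    rw [h0, map_zero] at hl
    exact WithZero.exp_ne_zero hl.symm
  have hlog : ∀ i, x i.succ ≠ 0 → WithZero.log (v (f i)) =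
      -(e : ℤ) * (i : ℕ) + p * WithZero.log (v (x i.succ)) := by
    intro i hi
    have hvi : v (x i.succ) ≠ 0 := by simpa using hi
    simp only [hf, map_mul, map_pow, hl]
    rw [WithZero.log_mul (pow_ne_zero _ WithZero.exp_ne_zero) (pow_ne_zero _ hvi),
      WithZero.log_pow, WithZero.log_pow, WithZero.log_exp]
    simp only [nsmul_eq_mul]
    ring
  have hfne : ∀ i, v (f i) ≠ 0 → x i.succ ≠ 0 := by
    intro i hi h0
    apply hi
    simp [hf, h0, hp.ne_zero]
  have hdv : ∀ i j : ℤ, (p : ℤ) ∣ e * (i - j) → (p : ℤ) ∣ i - j := by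
    intro i j hd
    rcases (Nat.prime_iff_prime_int.mp hp).dvd_or_dvd hd with h | h
    · exact absurd (by exact_mod_cast h) he
    · exact h
  have hinj : ∀ a b : Fin p, (p : ℤ) ∣ ((a : ℕ) : ℤ) - ((b : ℕ) : ℤ) → a = b := by
    intro a b hd
    have h1 := a.2
    have h2 := b.2
    have := Int.eq_zero_of_abs_lt_dvd hd (by rw [abs_lt]; constructor <;> omega)
    ext
    omega
  obtain ⟨j, -, hj⟩ := Finset.exists_max_image Finset.univ (fun i => v (f i)) ⟨0, Finset.mem_univ _⟩
  have hj0 : v (f j) ≠ 0 := by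
    intro h0
    have hz : ∀ i : Fin p, x i.succ = 0 := by
      intro i
      have h1 := hj i (Finset.mem_univ _)
      rw [h0, le_zero_iff] at h1
      have h2 : f i = 0 := by simpa using h1
      simp only [hf, mul_eq_zero] at h2
      rcases h2 with h2 | h2
      · exact absurd h2 (pow_ne_zero _ hlne)
      · exact pow_eq_zero_iff hp.ne_zero |>.mp h2
    have hα0 : (α : K) ≠ 0 := by
      intro h; rw [h, map_zero] at hα; exact zero_ne_one hα
    apply hx0
    ext i
    refine Fin.cases ?_ (fun i => hz i) i
    have : (α : K) * x 0 ^ p = 0 := by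
      rw [← hx]
      exact Finset.sum_eq_zero (fun i _ => by simp [hz, hp.ne_zero])
    rcases mul_eq_zero.mp this with h | h
    · exact absurd h hα0
    · exact pow_eq_zero_iff hp.ne_zero |>.mp h
  have hlt : ∀ i ∈ Finset.univ \ {j}, v (f i) < v (f j) := by
    intro i hi
    refine lt_of_le_of_ne (hj i (Finset.mem_univ _)) ?_
    intro heq
    have hij : i ≠ j := by simpa using hi
    apply hij
    have h1 := hlog i (hfne i (heq ▸ hj0))
    have h2 := hlog j (hfne j hj0)
    rw [heq, h2] at h1
    apply hinj
    apply hdv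
    exact ⟨WithZero.log (v (x i.succ)) - WithZero.log (v (x j.succ)), by linear_combination h1⟩
  have hsum := v.map_sum_eq_of_lt (Finset.mem_univ j) hlt
  have hx' : ∑ i, f i = (α : K) * x 0 ^ p := hx
  have hv0 : v (f j) = v (x 0) ^ p := by
    rw [← hsum, hx', map_mul, hα, one_mul, map_pow]
  have hx0ne : x 0 ≠ 0 := by
    intro h; rw [h, map_zero, zero_pow hp.ne_zero] at hv0; exact hj0 hv0
  have hjz : j = 0 := by
    apply hinj
    apply hdv
    have h2 := hlog j (hfne j hj0)
    rw [hv0, WithZero.log_pow, nsmul_eq_mul] at h2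
    exact ⟨WithZero.log (v (x j.succ)) - WithZero.log (v (x 0)), by
      simp only [Fin.val_zero, Nat.cast_zero]
      linear_combination h2⟩
  subst hjz
  have hf0 : f 0 = x (Fin.succ 0) ^ p := by simp [hf]
  refine ⟨x (Fin.succ 0) / x 0, ?_, ?_⟩
  · rw [map_div₀]
    have : v (x (Fin.succ 0)) = v (x 0) := by
      rw [hf0, map_pow] at hv0
      exact (pow_left_inj₀ zero_le zero_le hp.ne_zero).mp hv0
    rw [this]
    exact div_self_le_one _
  · have hrest : v (∑ i ∈ Finset.univ \ {0}, f i) < v (f 0) := v.map_sum_lt hj0 hlt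
    rw [Finset.sum_eq_add_sum_sdiff_singleton_of_mem (Finset.mem_univ 0)] at hx'
    have : (x (Fin.succ 0) / x 0) ^ p - (α : K) = - (∑ i ∈ Finset.univ \ {0}, f i) / x 0 ^ p := by
      rw [eq_div_iff (pow_ne_zero _ hx0ne), sub_mul, div_pow,
        div_mul_cancel₀ _ (pow_ne_zero _ hx0ne), ← hf0]
      linear_combination hx'
    rw [this, map_div₀, Valuation.map_neg, map_pow, ← hv0]
    exact (div_lt_one₀ (zero_lt_iff.mpr hj0)).mpr hrest

theorem aux_lower (p l : ℕ) [hpF : Fact p.Prime] [hlF : Fact l.Prime]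
    (α : ℤ) (hα : ¬ ∃ b : ZMod l, b ^ p = (α : ZMod l))
    (K : Type) [Field K] [NumberField K] (h : HasPoint p l α K) : p ∣ Module.finrank ℚ K := by
  have hp := hpF.out
  by_contra hnd
  have hlprime : Prime (l : ℤ) := Nat.prime_iff_prime_int.mp hlF.out
  let I : Ideal ℤ := Ideal.span {(l : ℤ)}
  have hI0 : I ≠ ⊥ := by simpa [I] using hlprime.ne_zero
  have hIp : I.IsPrime := (Ideal.span_singleton_prime hlprime.ne_zero).mpr hlprime
  have hImax : I.IsMaximal := hIp.isMaximal hI0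
  have hsum := Ideal.sum_ramification_inertia (NumberField.RingOfIntegers K) ℚ K hI0
  rw [← hsum] at hnd
  obtain ⟨P, hP, hPnd⟩ : ∃ P ∈ IsDedekindDomain.primesOverFinset I (NumberField.RingOfIntegers K),
      ¬ p ∣ Ideal.ramificationIdx' I P * Ideal.inertiaDeg' I P := by
    by_contra hcon
    push Not at hcon
    exact hnd (Finset.dvd_sum hcon)
  have hPp := (IsDedekindDomain.mem_primesOverFinset_iff hI0 _).mp hP
  have : P.IsPrime := hPp.1
  have hover : P.LiesOver I := hPp.2
  have hP0 : P ≠ ⊥ := Ideal.ne_bot_of_liesOver_of_ne_bot hI0 P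
  have hPmax : P.IsMaximal := Ideal.IsPrime.isMaximal this hP0
  let v : IsDedekindDomain.HeightOneSpectrum ℤ := ⟨I, hIp, hI0⟩
  let w : IsDedekindDomain.HeightOneSpectrum (NumberField.RingOfIntegers K) := ⟨P, this, hP0⟩
  have : w.asIdeal.LiesOver v.asIdeal := hover
  have hα' : α ∉ I := by
    intro hmem
    rw [Ideal.mem_span_singleton] at hmem
    apply hα
    exact ⟨0, by rw [zero_pow hp.ne_zero, (ZMod.intCast_zmod_eq_zero_iff_dvd α l).mpr hmem]⟩
  have hval : ∀ n : ℤ, w.valuation K (n : K) = v.intValuation n ^ Ideal.ramificationIdx' I P := by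
    intro n
    have h1 := IsDedekindDomain.HeightOneSpectrum.intValuation_liesOver v w n
    have h2 := w.valuation_of_algebraMap (K := K) (algebraMap ℤ (NumberField.RingOfIntegers K) n)
    rw [h1, ← h2]
    simp
  obtain ⟨y, hy1, hy2⟩ := aux_val (w.valuation K) p l hp α (Ideal.ramificationIdx' I P)
    (fun hd => hPnd (hd.mul_right _)) (by
      have := hval l
      rw [v.intValuation_singleton hlprime.ne_zero rfl, ← WithZero.exp_nsmul] at this
      simpa using this) (by
      rw [hval, v.intValuation_eq_one_iff.mpr hα', one_pow]) h
  obtain ⟨a, ha⟩ := w.exists_valuation_sub_lt_of_integer hy1 1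
  have hmem : a ^ p - (α : NumberField.RingOfIntegers K) ∈ P := by
    have h1 : w.valuation K (algebraMap _ K (a ^ p - (α : NumberField.RingOfIntegers K))) < 1 := by
      have ha1 : w.valuation K (algebraMap _ K a) ≤ 1 := w.valuation_le_one a
      obtain ⟨c, hc⟩ : ∃ c, c ∈ (w.valuation K).integer ∧
          (algebraMap _ K a) ^ p - y ^ p = (algebraMap _ K a - y) * c := by
        refine ⟨∑ i ∈ Finset.range p, (algebraMap _ K a) ^ i * y ^ (p - 1 - i), ?_, ?_⟩
        · refine Subring.sum_mem _ fun i _ => Subring.mul_mem _ (Subring.pow_mem _ ha1 _)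
            (Subring.pow_mem _ hy1 _)
        · rw [mul_comm]; exact (Commute.all _ _).geom_sum₂_mul p |>.symm
      have h2 : algebraMap _ K (a ^ p - (α : NumberField.RingOfIntegers K)) =
          (algebraMap _ K a - y) * c + (y ^ p - α) := by
        rw [← hc.2]; simp
      rw [h2]
      refine (w.valuation K).map_add_lt ?_ hy2
      rw [map_mul]
      exact mul_lt_one_of_lt_of_le ha hc.1
    exact (w.valuation_lt_one_iff_mem _).mp h1
  letI := Ideal.Quotient.field I
  letI := Ideal.Quotient.field P
  have hfin : ¬ p ∣ Module.finrank (ℤ ⧸ I) (NumberField.RingOfIntegers K ⧸ P) := by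
    rw [← Ideal.inertiaDeg'_algebraMap]
    exact fun hd => hPnd (hd.mul_left _)
  apply hfin
  have : FiniteDimensional (ℤ ⧸ I) (NumberField.RingOfIntegers K ⧸ P) := by
    by_contra hinf
    exact hfin (by rw [Module.finrank_of_not_finite hinf]; exact dvd_zero _)
  refine aux_dvd_finrank (a := Ideal.Quotient.mk I α) hp ?_ (Ideal.Quotient.mk P a) ?_
  · intro b hb
    apply hα
    refine ⟨Int.quotientSpanNatEquivZMod l b, ?_⟩
    rw [← map_pow, hb]
    have : Ideal.Quotient.mk I α = (α : ℤ ⧸ I) := by simp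
    rw [this]
    exact map_intCast (Int.quotientSpanNatEquivZMod l) α
  · rw [Ideal.Quotient.algebraMap_mk_of_liesOver, ← map_pow, Ideal.Quotient.eq]
    simpa using hmem

theorem aux_upper (p l : ℕ) [hpF : Fact p.Prime] [hlF : Fact l.Prime]
    (α : ℤ) (hα : ¬ ∃ b : ZMod l, b ^ p = (α : ZMod l)) :
    ∃ K : IntermediateField ℚ (AlgebraicClosure ℚ), FiniteDimensional ℚ K ∧ HasPoint p l α K ∧
      Module.finrank ℚ K = p := by
  have hp := hpF.out
  have : NeZero p := ⟨hp.ne_zero⟩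
  obtain ⟨b, hb⟩ := IsAlgClosed.exists_pow_nat_eq (α : AlgebraicClosure ℚ) hp.pos
  have hbi : IsIntegral ℚ b := by
    refine IsIntegral.of_pow hp.pos ?_
    rw [hb, ← map_intCast (algebraMap ℚ (AlgebraicClosure ℚ)) α]
    exact isIntegral_algebraMap
  have hfd : FiniteDimensional ℚ ℚ⟮b⟯ := IntermediateField.adjoin.finiteDimensional hbi
  have hnp : ∀ c : ℚ, c ^ p ≠ (α : ℚ) := by
    intro c hc
    obtain ⟨n, hn⟩ := IsIntegrallyClosed.exists_algebraMap_eq_of_isIntegral_pow (R := ℤ) (x := c)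
      hp.pos (by rw [hc]; exact isIntegral_algebraMap (R := ℤ) (x := α))
    apply hα
    refine ⟨(n : ZMod l), ?_⟩
    have : n ^ p = α := by
      rw [← hn] at hc
      simp only [algebraMap_int_eq, eq_intCast] at hc
      exact_mod_cast hc
    rw [← this]
    push_cast
    rfl
  have hg : (AdjoinSimple.gen ℚ b) ^ p = ((α : ℤ) : ℚ⟮b⟯) := by
    apply Subtype.ext
    simpa using hb
  refine ⟨ℚ⟮b⟯, hfd, ?_, ?_⟩
  · refine ⟨Fin.cons 1 (Pi.single 0 (AdjoinSimple.gen ℚ b)), ?_, ?_⟩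
    · intro h
      have := congrFun h 0
      simp at this
    · rw [Finset.sum_eq_single 0]
      · rw [Fin.cons_succ, Fin.cons_zero, Pi.single_eq_same, hg]
        simp
      · intro i _ hi
        simp [Pi.single_eq_of_ne hi, hp.ne_zero]
      · simp
  · rw [IntermediateField.adjoin.finrank hbi, aux_minpoly hp hnp b (by simpa using hb),
      Polynomial.natDegree_X_pow_sub_C]

/-- Let `p ≥ 5` and `l` be distinct primes with `p ∣ l - 1`, and `α` an
integer not a `p`-th power mod `l`. Let `X ⊂ ℙ^p_ℚ` be the hypersurface defined by
`x 1 ^ p + l * x 2 ^ p + ⋯ + l ^ (p-1) * x p ^ p = α * x 0 ^ p`. Then the index `I(X)`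
of `X` over `ℚ` equals `p`. -/
theorem stmt_9 (p l : ℕ) [Fact p.Prime] [Fact l.Prime] (hp5 : 5 ≤ p) (hpl : p ≠ l)
    (hdvd : p ∣ l - 1) (α : ℤ) (hα : ¬ ∃ b : ZMod l, b ^ p = (α : ZMod l)) :
    IsIndex p l α p := by
  constructor
  · intro K hK hpt
    have : NumberField K := ⟨⟩
    exact aux_lower p l α hα K hpt
  · intro d hd
    obtain ⟨K, h1, h2, h3⟩ := aux_upper p l α hα
    have := hd K h1 h2
    rwa [h3] at this
end

section
/- Let k be a perfect field whose absolute Galois group is a pro-p-group for a prime p ≠ char(k). If the p-torsion subgroup of the Brauer group Br(k) is trivial, then for every finite extension K/k the Brauer group Br(K) is trivial. -/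
open scoped TensorProduct PiTensorProduct


theorem kl_aux {K D R ι : Type*} [Field K] [DivisionRing D] [Algebra K D] [Algebra.IsCentral K D]
    [Ring R] [Algebra K R] (φ : D →ₐ[K] R) (b : ι → R) (hb : LinearIndependent K b)
    (hc : ∀ i d, φ d * b i = b i * φ d) :
    ∀ (s : Finset ι) (a : ι → D), ∑ i ∈ s, φ (a i) * b i = 0 → ∀ i ∈ s, a i = 0 := by
  classical
  intro s
  induction s using Finset.strongInduction with
  | H s ih =>
    intro a ha i0 hi0
    by_contra hne
    have ha' : ∑ i ∈ s, φ ((a i0)⁻¹ * a i) * b i = 0 := by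
      have := congrArg (fun y => φ ((a i0)⁻¹) * y) ha
      simpa [Finset.mul_sum, mul_assoc] using this
    have hcomm : ∀ x : D, ∀ i ∈ s, x * ((a i0)⁻¹ * a i) - ((a i0)⁻¹ * a i) * x = 0 := by
      intro x
      have h1 : ∑ i ∈ s, φ (x * ((a i0)⁻¹ * a i) - ((a i0)⁻¹ * a i) * x) * b i = 0 := by
        have e : ∀ i ∈ s, φ (x * ((a i0)⁻¹ * a i) - ((a i0)⁻¹ * a i) * x) * b i =
            φ x * (φ ((a i0)⁻¹ * a i) * b i) - (φ ((a i0)⁻¹ * a i) * b i) * φ x := by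
          intro i _
          rw [map_sub, map_mul φ x, map_mul φ _ x, sub_mul, mul_assoc, mul_assoc, hc i x, mul_assoc]
        rw [Finset.sum_congr rfl e, Finset.sum_sub_distrib, ← Finset.mul_sum, ← Finset.sum_mul, ha']
        simp
      rw [← Finset.add_sum_erase s _ hi0] at h1
      simp only [inv_mul_cancel₀ hne, mul_one, one_mul, sub_self, map_zero, zero_mul,
        zero_add] at h1
      intro i hi
      by_cases hii : i = i0
      · subst hii; simp [inv_mul_cancel₀ hne]
      · exact ih (s.erase i0) (Finset.erase_ssubset hi0) _ h1 i (Finset.mem_erase.2 ⟨hii, hi⟩)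
    have hk : ∀ i, ∃ r : K, i ∈ s → (a i0)⁻¹ * a i = algebraMap K D r := by
      intro i
      by_cases hi : i ∈ s
      · have : (a i0)⁻¹ * a i ∈ Subalgebra.center K D := by
          rw [Subalgebra.mem_center_iff]
          intro x
          exact sub_eq_zero.1 (hcomm x i hi)
        obtain ⟨r, hr⟩ := Algebra.IsCentral.mem_center_iff K |>.1 this
        exact ⟨r, fun _ => hr⟩
      · exact ⟨0, fun h => absurd h hi⟩
    choose r hr using hk
    have h2 : ∑ i ∈ s, r i • b i = 0 := by
      rw [← ha']
      refine Finset.sum_congr rfl fun i hi => ?_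
      rw [hr i hi, AlgHom.commutes, Algebra.smul_def]
    have h3 := linearIndependent_iff'.1 hb s r h2 i0 hi0
    have h4 := hr i0 hi0
    rw [h3, inv_mul_cancel₀ hne, map_zero] at h4
    exact one_ne_zero h4

theorem li_prod {K D R κ : Type*} [Field K] [DivisionRing D] [Algebra K D] [Algebra.IsCentral K D]
    [Ring R] [Nontrivial R] [Algebra K R] (β : κ → D) (hβ : LinearIndependent K β) :
    ∀ (n : ℕ) (φ : Fin n → (D →ₐ[K] R)),
      (∀ i j, i ≠ j → ∀ x y, φ i x * φ j y = φ j y * φ i x) →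
      LinearIndependent K (fun I : Fin n → κ => (List.ofFn (fun l => φ l (β (I l)))).prod) := by
  intro n
  induction n with
  | zero =>
    intro φ _
    simp only [List.ofFn_zero, List.prod_nil]
    exact LinearIndependent.of_subsingleton default one_ne_zero
  | succ n ih =>
    intro φ hφ
    have h1 := ih (fun l => φ l.succ) (fun i j hij x y =>
      hφ _ _ (fun h => hij (Fin.succ_injective _ h)) x y)
    set b : (Fin n → κ) → R := fun I => (List.ofFn (fun l => φ l.succ (β (I l)))).prod with hbdef
    have hcb : ∀ I d, φ 0 d * b I = b I * φ 0 d := by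
      intro I d
      show Commute _ _
      refine Commute.list_prod_right _ _ ?_
      intro y hy
      rw [List.mem_ofFn] at hy
      obtain ⟨l, rfl⟩ := hy
      exact hφ _ _ (Fin.succ_ne_zero l).symm _ _
    have h2 : LinearIndependent K (fun q : κ × (Fin n → κ) => φ 0 (β q.1) * b q.2) := by
      rw [linearIndependent_iff']
      intro s g hg q hq
      classical
      have h3 : ∑ I ∈ s.image Prod.snd,
          φ 0 (∑ x ∈ s.image Prod.fst, (if (x, I) ∈ s then g (x, I) else 0) • β x) * b I = 0 := by
        rw [← hg]
        simp only [map_sum, Finset.sum_mul, map_smul, smul_mul_assoc]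
        rw [Finset.sum_comm, ← Finset.sum_product'
          (f := fun x I => (if (x, I) ∈ s then g (x, I) else 0) • (φ 0 (β x) * b I))]
        symm
        refine Finset.sum_subset_zero_on_sdiff ?_ ?_ ?_
        · intro y hy
          exact Finset.mem_product.2 ⟨Finset.mem_image_of_mem _ hy, Finset.mem_image_of_mem _ hy⟩
        · intro y hy
          rw [if_neg (Finset.mem_sdiff.1 hy).2, zero_smul]
        · intro y hy
          rw [if_pos hy]
      have h4 := kl_aux (φ 0) b h1 hcb _ _ h3 q.2 (Finset.mem_image_of_mem _ hq)
      have h5 := linearIndependent_iff'.1 hβ _ _ h4 q.1 (Finset.mem_image_of_mem _ hq)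
      simpa [hq] using h5
    have h6 := h2.comp (fun I : Fin (n+1) → κ => (I 0, fun l => I l.succ)) (by
      intro I J h
      simp only [Prod.mk.injEq] at h
      funext l
      refine Fin.cases h.1 (fun l => congrFun h.2 l) l)
    convert h6 using 2 with I
    simp [List.ofFn_succ, hbdef]

theorem ofFn_mul_prod {R : Type*} [Monoid R] : ∀ (n : ℕ) (x y : Fin n → R),
    (∀ i j, i ≠ j → x i * y j = y j * x i) →
    (List.ofFn (fun l => x l * y l)).prod = (List.ofFn x).prod * (List.ofFn y).prod := by
  intro n
  induction n with
  | zero => intro x y _; simp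
  | succ n ih =>
    intro x y h
    rw [List.ofFn_succ, List.ofFn_succ (f := x), List.ofFn_succ (f := y), List.prod_cons,
      List.prod_cons, List.prod_cons,
      ih _ _ (fun i j hij => h _ _ (fun h => hij (Fin.succ_injective _ h)))]
    have : Commute (y 0) (List.ofFn (fun i : Fin n => x i.succ)).prod := by
      refine Commute.list_prod_right _ _ ?_
      intro z hz
      rw [List.mem_ofFn] at hz
      obtain ⟨l, rfl⟩ := hz
      exact (h _ _ (Fin.succ_ne_zero l)).symm
    rw [mul_assoc, ← mul_assoc (y 0), this.eq]
    simp only [mul_assoc]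

/-- The homomorphism out of a tensor power given by commuting homomorphisms. -/
noncomputable def piHom {K D R : Type*} [Field K] [Ring D] [Algebra K D]
    [Ring R] [Algebra K R] (n : ℕ) (φ : Fin n → (D →ₐ[K] R))
    (hφ : ∀ i j, i ≠ j → ∀ x y, φ i x * φ j y = φ j y * φ i x) :
    (⨂[K] (_ : Fin n), D) →ₐ[K] R :=
  PiTensorProduct.liftAlgHom
    ((MultilinearMap.mkPiAlgebraFin K n R).compLinearMap (fun l => (φ l).toLinearMap))
    (by simp) (by
      intro x y
      simp only [MultilinearMap.compLinearMap_apply, MultilinearMap.mkPiAlgebraFin_apply,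
        AlgHom.toLinearMap_apply, Pi.mul_apply, map_mul]
      exact ofFn_mul_prod n _ _ (fun i j hij => hφ i j hij _ _))

theorem piHom_tprod {K D R : Type*} [Field K] [Ring D] [Algebra K D]
    [Ring R] [Algebra K R] (n : ℕ) (φ : Fin n → (D →ₐ[K] R))
    (hφ : ∀ i j, i ≠ j → ∀ x y, φ i x * φ j y = φ j y * φ i x) (x : Fin n → D) :
    piHom n φ hφ (PiTensorProduct.tprod K x) = (List.ofFn (fun l => φ l (x l))).prod := by
  simp [piHom, PiTensorProduct.liftAlgHom]

theorem piHom_injective {K D R : Type*} [Field K] [DivisionRing D] [Algebra K D]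
    [Algebra.IsCentral K D] [Ring R] [Nontrivial R] [Algebra K R] (n : ℕ)
    (φ : Fin n → (D →ₐ[K] R))
    (hφ : ∀ i j, i ≠ j → ∀ x y, φ i x * φ j y = φ j y * φ i x) :
    Function.Injective (piHom n φ hφ) := by
  let β := Module.Free.chooseBasis K D
  let B := Basis.piTensorProduct (fun _ : Fin n => β)
  have h := li_prod β β.linearIndependent n φ hφ
  have h2 : LinearIndependent K (fun I => (piHom n φ hφ).toLinearMap (B I)) := by
    convert h using 2 with I
    simp only [B, Basis.piTensorProduct_apply, AlgHom.toLinearMap_apply, piHom_tprod]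
  exact LinearMap.injective_of_linearIndependent B.span_eq h2

theorem tensor_split {K D V : Type*} [Field K] [DivisionRing D] [Algebra K D]
    [Algebra.IsCentral K D] [FiniteDimensional K D] [AddCommGroup V] [Module K V]
    [FiniteDimensional K V] [Nontrivial V] (n : ℕ) (φ : Fin n → (D →ₐ[K] Module.End K V))
    (hφ : ∀ i j, i ≠ j → ∀ x y, φ i x * φ j y = φ j y * φ i x)
    (hdim : Module.finrank K V ^ 2 ≤ Module.finrank K D ^ n) :
    ∃ m : ℕ, 0 < m ∧ Nonempty ((⨂[K] (_ : Fin n), D) ≃ₐ[K] Matrix (Fin m) (Fin m) K) := by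
  have hinj := piHom_injective n φ hφ
  let β := Module.Free.chooseBasis K D
  let B := Basis.piTensorProduct (fun _ : Fin n => β)
  have : Module.Finite K (⨂[K] (_ : Fin n), D) := Module.Finite.of_basis B
  have hd : Module.finrank K (⨂[K] (_ : Fin n), D) = Module.finrank K D ^ n := by
    rw [Module.finrank_eq_card_basis B, Module.finrank_eq_card_basis β]; simp
  have hle : Module.finrank K (⨂[K] (_ : Fin n), D) = Module.finrank K (Module.End K V) := by
    refine le_antisymm (LinearMap.finrank_le_finrank_of_injective
      (f := (piHom n φ hφ).toLinearMap) hinj) ?_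
    rw [hd, Module.finrank_linearMap, ← sq]
    exact hdim
  have hbij : Function.Bijective (piHom n φ hφ) :=
    ⟨hinj, (LinearMap.injective_iff_surjective_of_finrank_eq_finrank
      (f := (piHom n φ hφ).toLinearMap) hle).1 hinj⟩
  refine ⟨Module.finrank K V, Module.finrank_pos, ⟨(AlgEquiv.ofBijective _ hbij).trans
    (LinearMap.toMatrixAlgEquiv (Module.finBasis K V))⟩⟩

theorem central_of_matrix {K D : Type*} [Field K] [DivisionRing D] [Algebra K D] (m : ℕ) [NeZero m]
    (h : Algebra.IsCentral K (Matrix (Fin m) (Fin m) D)) : Algebra.IsCentral K D := by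
  refine ⟨fun x hx => ?_⟩
  have h1 : Matrix.scalar (Fin m) x ∈ Subalgebra.center K (Matrix (Fin m) (Fin m) D) := by
    rw [Subalgebra.mem_center_iff]
    intro M
    rw [Subalgebra.mem_center_iff] at hx
    exact ((Matrix.scalar_commute x (fun r => (hx r).symm) M).eq).symm
  obtain ⟨r, hr⟩ := (Algebra.IsCentral.mem_center_iff K).1 h1
  have h2 := congrFun (congrFun hr 0) 0
  rw [Matrix.algebraMap_matrix_apply] at h2
  simp at h2
  rw [Algebra.mem_bot]
  exact ⟨r, h2.symm⟩

theorem csa_split (p : ℕ) {k : Type} [Field k]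
    (htors : ∀ (D : Type) [DivisionRing D] [Algebra k D] [FiniteDimensional k D]
      [Algebra.IsCentral k D],
      (∃ n : ℕ, 0 < n ∧
        Nonempty ((⨂[k] (_ : Fin p), D) ≃ₐ[k] Matrix (Fin n) (Fin n) k)) →
      Module.finrank k D = 1)
    (A : Type) [Ring A] [Algebra k A] [FiniteDimensional k A] [IsSimpleRing A]
    [Algebra.IsCentral k A] (V : Type) [AddCommGroup V] [Module k V] [FiniteDimensional k V]
    [Nontrivial V] (ρ : Fin p → (A →ₐ[k] Module.End k V))
    (hρ : ∀ i j, i ≠ j → ∀ x y, ρ i x * ρ j y = ρ j y * ρ i x)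
    (hdim : Module.finrank k V ^ 2 ≤ Module.finrank k A ^ p) :
    ∃ m : ℕ, Nonempty (A ≃ₐ[k] Matrix (Fin m) (Fin m) k) := by
  have : IsArtinianRing A := IsArtinianRing.of_finite k A
  obtain ⟨m, hm, D, _, _, _, ⟨e⟩⟩ := IsSimpleRing.exists_algEquiv_matrix_divisionRing_finite k A
  have hcen : Algebra.IsCentral k (Matrix (Fin m) (Fin m) D) := Algebra.IsCentral.of_algEquiv k A _ e
  have hcenD : Algebra.IsCentral k D := central_of_matrix m hcen
  suffices hD : Module.finrank k D = 1 by
    have hb : Function.Bijective (Algebra.ofId k D) := by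
      refine ⟨(algebraMap k D).injective, ?_⟩
      refine (LinearMap.injective_iff_surjective_of_finrank_eq_finrank
        (f := (Algebra.ofId k D).toLinearMap) (by simp [hD])).1 (algebraMap k D).injective
    exact ⟨m, ⟨e.trans (AlgEquiv.ofBijective _ hb).symm.mapMatrix⟩⟩
  let u : Fin m → Fin m → A := fun i j => e.symm (Matrix.single i j 1)
  have hu : ∀ i j l, u i j * u j l = u i l := by
    intro i j l
    simp [u, ← map_mul]
  have hu1 : ∑ i, u i i = 1 := by
    simp only [u, ← map_sum]
    rw [Matrix.sum_single_one, map_one]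
  have hu0 : ∀ i j j' l, j ≠ j' → u i j * u j' l = 0 := by
    intro i j j' l h
    simp only [u, ← map_mul]
    rw [Matrix.single_mul_single_of_ne _ _ _ _ h, map_zero]
  let P := piHom p ρ hρ
  let T : (Fin p → A) → (⨂[k] (_ : Fin p), A) := fun x => PiTensorProduct.tprod k x
  let Eu : (Fin p → Fin m) → (Fin p → Fin m) → Module.End k V :=
    fun I J => P (T (fun l => u (I l) (J l)))
  have hE : ∀ I J L, Eu I J * Eu J L = Eu I L := by
    intro I J L
    simp only [Eu, T, ← map_mul, PiTensorProduct.tprod_mul_tprod]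
    congr 2
    funext l
    exact hu _ _ _
  have hE0 : ∀ I J J' L, J ≠ J' → Eu I J * Eu J' L = 0 := by
    intro I J J' L h
    obtain ⟨l, hl⟩ := Function.ne_iff.1 h
    simp only [Eu, T, ← map_mul, PiTensorProduct.tprod_mul_tprod]
    rw [MultilinearMap.map_coord_zero _ l, map_zero]
    exact hu0 _ _ _ _ hl
  have hE1 : ∑ I, Eu I I = 1 := by
    simp only [Eu, T, ← map_sum]
    rw [← MultilinearMap.map_sum (PiTensorProduct.tprod k) (fun (_ : Fin p) (i : Fin m) => u i i)]
    simp only [hu1]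
    exact map_one P
  let ψ : Fin p → (D →ₐ[k] Module.End k V) := fun l =>
    (ρ l).comp (e.symm.toAlgHom.comp (Matrix.scalarAlgHom (Fin m) k))
  have hψ : ∀ l d I J, ψ l d * Eu I J = Eu I J * ψ l d := by
    intro l d I J
    simp only [Eu, P, T, piHom_tprod]
    show Commute _ _
    refine Commute.list_prod_right _ _ ?_
    intro y hy
    rw [List.mem_ofFn] at hy
    obtain ⟨l', rfl⟩ := hy
    by_cases hl : l = l'
    · subst hl
      show ρ l (e.symm (Matrix.scalar (Fin m) d)) * ρ l (u _ _) = ρ l (u _ _) * ρ l (e.symm (Matrix.scalar (Fin m) d))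
      simp only [u, ← map_mul]
      congr 2
      ext a b
      simp [Matrix.single]
    · exact hρ _ _ hl _ _
  let I0 : Fin p → Fin m := fun _ => 0
  let V' : Submodule k V := LinearMap.range (Eu I0 I0)
  have hV' : ∀ w ∈ V', Eu I0 I0 w = w := by
    rintro _ ⟨v, rfl⟩
    exact congrArg (fun f : Module.End k V => f v) (hE I0 I0 I0)
  have hst : ∀ l d, ∀ w ∈ V', ψ l d w ∈ V' := by
    intro l d w hw
    refine ⟨ψ l d w, ?_⟩
    have := congrArg (fun f : Module.End k V => f w) (hψ l d I0 I0)
    simp only [Module.End.mul_apply] at this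
    rw [← this, hV' w hw]
  let ψ' : Fin p → (D →ₐ[k] Module.End k V') := fun l =>
    AlgHom.ofLinearMap
      { toFun := fun d => (ψ l d).restrict (hst l d)
        map_add' := fun a b => by ext w; simp
        map_smul' := fun a b => by ext w; simp }
      (by ext w; simp) (fun a b => by ext w; simp)
  have hψ'c : ∀ i j, i ≠ j → ∀ x y, ψ' i x * ψ' j y = ψ' j y * ψ' i x := by
    intro i j hij x y
    ext w
    have := congrArg (fun f : Module.End k V => f w) (hρ i j hij
      (e.symm (Matrix.scalar (Fin m) x)) (e.symm (Matrix.scalar (Fin m) y)))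
    exact this
  have hnt : Nontrivial V' := by
    by_contra hcon
    rw [not_nontrivial_iff_subsingleton, Submodule.subsingleton_iff_eq_bot,
      LinearMap.range_eq_bot] at hcon
    have h0 : ∀ I, Eu I I = 0 := by
      intro I
      rw [← hE I I0 I, ← hE I0 I0 I, hcon, zero_mul, mul_zero]
    rw [Finset.sum_congr rfl (fun I _ => h0 I)] at hE1
    simp at hE1
  have hdimV : m ^ p * Module.finrank k V' ≤ Module.finrank k V := by
    let Φ : ((Fin p → Fin m) → V') →ₗ[k] V :=
      ∑ I, (Eu I I0) ∘ₗ V'.subtype ∘ₗ LinearMap.proj I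
    have hΦ : Function.Injective Φ := by
      rw [injective_iff_map_eq_zero]
      intro w hw
      funext J
      have h1 : Eu I0 J (Φ w) = w J := by
        simp only [Φ, LinearMap.sum_apply, map_sum, LinearMap.comp_apply, LinearMap.proj_apply,
          Submodule.subtype_apply]
        rw [Finset.sum_eq_single J]
        · have := congrArg (fun f : Module.End k V => f (w J)) (hE I0 J I0)
          simp only [Module.End.mul_apply] at this
          rw [this, hV' _ (w J).2]
        · intro I _ hI
          exact congrArg (fun f : Module.End k V => f (w I)) (hE0 I0 J I I0 hI.symm)
        · simp
      rw [hw, map_zero] at h1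
      exact Subtype.ext h1.symm
    have := LinearMap.finrank_le_finrank_of_injective hΦ
    simpa [Module.finrank_pi_fintype] using this
  refine htors D (tensor_split p ψ' hψ'c ?_)
  have hA : Module.finrank k A = m * m * Module.finrank k D := by
    rw [e.toLinearEquiv.finrank_eq, Module.finrank_matrix]; simp
  have hmp : 0 < m := Nat.pos_of_ne_zero (NeZero.ne m)
  have h3 : (m ^ p) ^ 2 * Module.finrank k V' ^ 2 ≤ (m ^ p) ^ 2 * Module.finrank k D ^ p := by
    calc (m ^ p) ^ 2 * Module.finrank k V' ^ 2 = (m ^ p * Module.finrank k V') ^ 2 := by ring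
      _ ≤ Module.finrank k V ^ 2 := Nat.pow_le_pow_left hdimV 2
      _ ≤ _ := hdim
      _ = _ := by rw [hA]; ring
  exact Nat.le_of_mul_le_mul_left h3 (by positivity)


section crossed
open scoped Classical
variable {k E : Type} [Field k] [Field E] [Algebra k E] [FiniteDimensional k E]

/-- The crossed product algebra attached to a 2-cocycle `z`, as a form of a matrix algebra. -/
noncomputable def crossAlg (z : Gal(E/k) → Gal(E/k) → k) : Subalgebra k (Matrix (Gal(E/k)) (Gal(E/k)) E) where
  carrier := {M | ∀ s t r, algebraMap k E (z t r) * M (s * r) (t * r) =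
    algebraMap k E (z s r) * r⁻¹ (M s t)}
  mul_mem' := by
    intro M N hM hN s t r
    rw [Matrix.mul_apply, Matrix.mul_apply, map_sum, Finset.mul_sum, Finset.mul_sum,
      ← Equiv.sum_comp (Equiv.mulRight r)]
    refine Finset.sum_congr rfl fun u _ => ?_
    simp only [Equiv.coe_mulRight, map_mul]
    rw [← mul_assoc _ (r⁻¹ (M s u)), ← hM s u r]
    calc _ = M (s * r) (u * r) * (algebraMap k E (z t r) * N (u * r) (t * r)) := by ring
      _ = _ := by rw [hN u t r]; ring
  add_mem' := by
    intro M N hM hN s t r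
    simp only [Matrix.add_apply, map_add, mul_add, hM s t r, hN s t r]
  algebraMap_mem' := by
    intro a s t r
    simp only [Matrix.algebraMap_matrix_apply, mul_left_inj]
    by_cases h : s = t
    · simp [h]
    · simp [h]

variable (z : Gal(E/k) → Gal(E/k) → k)

theorem mem_crossAlg {M : Matrix (Gal(E/k)) (Gal(E/k)) E} : M ∈ crossAlg z ↔
    ∀ s t r, algebraMap k E (z t r) * M (s * r) (t * r) =
    algebraMap k E (z s r) * r⁻¹ (M s t) := Iff.rfl

noncomputable def lamM (x : E) : Matrix (Gal(E/k)) (Gal(E/k)) E :=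
  Matrix.diagonal (fun s => s⁻¹ x)

noncomputable def uM (t : Gal(E/k)) : Matrix (Gal(E/k)) (Gal(E/k)) E :=
  Matrix.of (fun s u => if s = t * u then algebraMap k E (z t u) else 0)

theorem lamM_mem (x : E) : lamM x ∈ crossAlg z := by
  intro s t r
  by_cases h : s = t
  · subst h
    simp only [lamM, Matrix.diagonal_apply_eq]
    rfl
  · simp [lamM, h]

theorem uM_mem (hz : ∀ a b d, z a b * z (a * b) d = z b d * z a (b * d)) (t : Gal(E/k)) :
    uM z t ∈ crossAlg z := by
  intro s u r
  by_cases h : s = t * u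
  · subst h
    simp only [uM, Matrix.of_apply, mul_assoc, if_true, AlgEquiv.commutes, ← map_mul]
    rw [← hz, mul_comm]
  · simp [uM, h, ← mul_assoc]

theorem uM_mul_lamM (t : Gal(E/k)) (x : E) : uM z t * lamM x = lamM (t x) * uM z t := by
  ext s u
  simp only [lamM, Matrix.mul_diagonal, Matrix.diagonal_mul, uM, Matrix.of_apply]
  by_cases h : s = t * u
  · subst h
    simp [mul_comm]
  · simp [h]

theorem uM_mul_uM (hz : ∀ a b d, z a b * z (a * b) d = z b d * z a (b * d)) (t r : Gal(E/k)) :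
    uM z t * uM z r = z t r • uM z (t * r) := by
  ext s v
  simp only [Matrix.mul_apply, uM, Matrix.of_apply, Matrix.smul_apply]
  rw [Finset.sum_eq_single (r * v)]
  · simp only [if_true, ← mul_assoc]
    split_ifs
    · rw [← map_mul, Algebra.smul_def, ← map_mul, hz, mul_comm]
    · simp
  · intro u _ hu
    simp [hu]
  · simp

theorem lamM_mul (x y : E) : (lamM x : Matrix (Gal(E/k)) (Gal(E/k)) E) * lamM y = lamM (x * y) := by
  simp [lamM, Matrix.diagonal_mul_diagonal]

theorem lamM_one : (lamM 1 : Matrix (Gal(E/k)) (Gal(E/k)) E) = 1 := by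
  simp [lamM]

theorem cross_ext (hz0 : ∀ a b, z a b ≠ 0) {M N : Matrix (Gal(E/k)) (Gal(E/k)) E}
    (hM : M ∈ crossAlg z) (hN : N ∈ crossAlg z) (h : ∀ s, M s 1 = N s 1) : M = N := by
  ext s u
  have h1 := hM (s * u⁻¹) 1 u
  have h2 := hN (s * u⁻¹) 1 u
  rw [h, ← h2] at h1
  have := mul_left_cancel₀ (by simpa using hz0 1 u) h1
  simpa using this

theorem cross_simple [IsGalois k E] (hz0 : ∀ a b, z a b ≠ 0)
    (hz : ∀ a b d, z a b * z (a * b) d = z b d * z a (b * d)) :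
    IsSimpleRing (crossAlg z) := by
  refine ⟨{ toNontrivial := inferInstance, eq_bot_or_eq_top := fun I => ?_ }⟩
  rw [or_iff_not_imp_left]
  intro hI
  let L : E → crossAlg z := fun x => ⟨lamM x, lamM_mem z x⟩
  let U : Gal(E/k) → crossAlg z := fun t => ⟨uM z t, uM_mem z hz t⟩
  obtain ⟨M, hMI, hM0⟩ : ∃ M ∈ I, M ≠ 0 := by
    by_contra hcon
    push Not at hcon
    exact hI (eq_bot_iff.2 fun x hx => (TwoSidedIdeal.mem_bot _).2 (hcon x hx))
  obtain ⟨τ, hτ⟩ : ∃ τ, M.1 τ 1 ≠ 0 := by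
    by_contra hcon
    push Not at hcon
    exact hM0 (Subtype.ext (cross_ext z hz0 M.2 (zero_mem _) (by simpa using hcon)))
  have key : ∀ S : Finset (Gal(E/k)), 1 ∉ S → ∃ N ∈ I, N.1 1 1 ≠ 0 ∧ ∀ τ ∈ S, N.1 τ 1 = 0 := by
    intro S
    induction S using Finset.induction_on with
    | empty =>
      intro _
      refine ⟨U τ⁻¹ * M, I.mul_mem_left _ _ hMI, ?_, by simp⟩
      show (uM z τ⁻¹ * M.1) 1 1 ≠ 0
      rw [Matrix.mul_apply, Finset.sum_eq_single τ]
      · simp [uM, hz0, hτ]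
      · intro b _ hb
        have : ¬ (1 = τ⁻¹ * b) := by
          intro h
          exact hb (by rw [eq_inv_mul_iff_mul_eq, mul_one] at h; exact h.symm)
        simp [uM, this]
      · simp
    | insert a S ha ih =>
      intro h1
      rw [Finset.mem_insert, not_or] at h1
      obtain ⟨N, hN, hN1, hNS⟩ := ih h1.2
      obtain ⟨x, hx⟩ : ∃ x, a x ≠ x := by
        by_contra hcon
        push Not at hcon
        exact h1.1 (AlgEquiv.ext hcon).symm
      have hent : ∀ s, (N * L x - L (a x) * N).1 s 1 = (x - s⁻¹ (a x)) * N.1 s 1 := by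
        intro s
        show (N.1 * lamM x - lamM (a x) * N.1 : Matrix (Gal(E/k)) (Gal(E/k)) E) s 1 = _
        simp only [lamM, Matrix.sub_apply, Matrix.mul_diagonal, Matrix.diagonal_mul]
        simp
        ring
      refine ⟨N * L x - L (a x) * N, I.sub_mem (I.mul_mem_right _ _ hN) (I.mul_mem_left _ _ hN),
        ?_, ?_⟩
      · rw [hent]
        refine mul_ne_zero ?_ hN1
        simpa [sub_eq_zero] using hx.symm
      · intro s hs
        rw [hent]
        rcases Finset.mem_insert.1 hs with rfl | hs
        · simp
        · rw [hNS s hs, mul_zero]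
  obtain ⟨N, hN, hN1, hNS⟩ := key (Finset.univ.erase 1) (by simp)
  have hNL : N = L (N.1 1 1) := by
    refine Subtype.ext (cross_ext z hz0 N.2 (L _).2 ?_)
    intro s
    by_cases hs : s = 1
    · subst hs; simp only [L, lamM, Matrix.diagonal_apply_eq]; rfl
    · rw [hNS s (by simp [hs])]
      simp [L, lamM, hs]
  rw [eq_top_iff]
  have h1 : (1 : crossAlg z) ∈ I := by
    have : (1 : crossAlg z) = L (N.1 1 1)⁻¹ * N := by
      refine Subtype.ext ?_
      show (1 : Matrix (Gal(E/k)) (Gal(E/k)) E) = lamM (N.1 1 1)⁻¹ * N.1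
      have h' : N.1 = lamM (N.1 1 1) := congrArg Subtype.val hNL
      have h'' : lamM (N.1 1 1)⁻¹ * N.1 = lamM (N.1 1 1)⁻¹ * lamM (N.1 1 1) :=
        congrArg (fun y => lamM (N.1 1 1)⁻¹ * y) h'
      rw [h'', lamM_mul, inv_mul_cancel₀ hN1, lamM_one]
    rw [this]
    exact I.mul_mem_left _ _ hN
  intro x _
  simpa using I.mul_mem_left x _ h1

theorem cross_central [IsGalois k E] (hz0 : ∀ a b, z a b ≠ 0)
    (hz : ∀ a b d, z a b * z (a * b) d = z b d * z a (b * d)) :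
    Algebra.IsCentral k (crossAlg z) := by
  refine ⟨fun M hM => ?_⟩
  rw [Subalgebra.mem_center_iff] at hM
  let L : E → crossAlg z := fun x => ⟨lamM x, lamM_mem z x⟩
  let U : Gal(E/k) → crossAlg z := fun t => ⟨uM z t, uM_mem z hz t⟩
  have h1 : ∀ s, s ≠ 1 → M.1 s 1 = 0 := by
    intro s hs
    obtain ⟨x, hx⟩ : ∃ x, s x ≠ x := by
      by_contra hcon
      push Not at hcon
      exact hs (AlgEquiv.ext hcon)
    have h := congrFun (congrFun (congrArg Subtype.val (hM (L (s x)))) s) 1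
    change (lamM (s x) * M.1 : Matrix (Gal(E/k)) (Gal(E/k)) E) s 1 = (M.1 * lamM (s x) : Matrix (Gal(E/k)) (Gal(E/k)) E) s 1 at h
    simp only [lamM, Matrix.mul_diagonal, Matrix.diagonal_mul] at h
    simp at h
    have h2 : (s x - x) * M.1 s 1 = 0 := by rw [sub_mul, h]; ring
    exact (mul_eq_zero.1 h2).resolve_left (sub_ne_zero.2 hx)
  have hML : M.1 = lamM (M.1 1 1) := by
    refine cross_ext z hz0 M.2 (lamM_mem z _) ?_
    intro s
    by_cases hs : s = 1
    · subst hs; simp only [lamM, Matrix.diagonal_apply_eq]; rfl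
    · rw [h1 s hs]
      simp [lamM, hs]
  have h2 : ∀ t : Gal(E/k), t (M.1 1 1) = M.1 1 1 := by
    intro t
    have h := congrFun (congrFun (congrArg Subtype.val (hM (U t))) t) 1
    change (uM z t * M.1) t 1 = (M.1 * uM z t) t 1 at h
    rw [hML] at h
    simp only [lamM, Matrix.mul_diagonal, Matrix.diagonal_mul] at h
    simp [uM] at h
    have h3 : M.1 1 1 = t⁻¹ (M.1 1 1) := by
      have : (algebraMap k E) (z t 1) ≠ 0 := by simpa using hz0 t 1
      rw [mul_comm] at h
      exact mul_right_cancel₀ this h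
    conv_lhs => rw [h3]
    simp
  obtain ⟨r, hr⟩ := (IsGalois.mem_range_algebraMap_iff_fixed (F := k) (E := E) (M.1 1 1)).2 h2
  rw [Algebra.mem_bot]
  refine ⟨r, Subtype.ext ?_⟩
  rw [hML, ← hr]
  show algebraMap k (Matrix _ _ E) r = _
  ext s t
  simp [lamM, Matrix.algebraMap_matrix_apply, Matrix.diagonal_apply]

theorem cross_finrank [IsGalois k E] (hz0 : ∀ a b, z a b ≠ 0)
    (hz : ∀ a b d, z a b * z (a * b) d = z b d * z a (b * d)) :
    Module.finrank k (crossAlg z) = Module.finrank k E ^ 2 := by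
  let Φ : crossAlg z →ₗ[k] (Gal(E/k) → E) :=
    { toFun := fun M s => M.1 s 1
      map_add' := fun M N => rfl
      map_smul' := fun a M => rfl }
  have hinj : Function.Injective Φ := fun M N h =>
    Subtype.ext (cross_ext z hz0 M.2 N.2 (fun s => congrFun h s))
  have hsurj : Function.Surjective Φ := by
    intro g
    refine ⟨⟨∑ t : Gal(E/k), lamM (t (g t * (algebraMap k E (z t 1))⁻¹)) * uM z t,
      sum_mem fun t _ => mul_mem (lamM_mem z _) (uM_mem z hz t)⟩, ?_⟩
    funext s
    show (∑ t : Gal(E/k), lamM (t (g t * (algebraMap k E (z t 1))⁻¹)) * uM z t : Matrix (Gal(E/k)) (Gal(E/k)) E) s 1 = _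
    rw [Matrix.sum_apply, Finset.sum_eq_single s]
    · simp [lamM, uM, Matrix.diagonal_mul, hz0]
    · intro t _ ht
      simp [lamM, uM, Matrix.diagonal_mul, ht.symm]
    · simp
  rw [(LinearEquiv.ofBijective Φ ⟨hinj, hsurj⟩).finrank_eq, Module.finrank_pi_fintype]
  simp [← Nat.card_eq_fintype_card, IsGalois.card_aut_eq_finrank, sq]
end crossed


section coordrep
open scoped Classical

/-- A matrix acting on the `i`-th coordinate. -/
noncomputable def coordRep (k : Type) {E Q : Type} [Field k] [Field E] [Algebra k E] [Fintype Q] {p : ℕ}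
    (i : Fin p) : Matrix Q Q E →ₐ[k] Module.End k ((Fin p → Q) → E) :=
  AlgHom.ofLinearMap
    { toFun := fun M =>
        { toFun := fun f s => ∑ u, M (s i) u * f (Function.update s i u)
          map_add' := fun f g => by
            funext s
            simp [mul_add, Finset.sum_add_distrib]
          map_smul' := fun a f => by
            funext s
            simp [Finset.smul_sum] }
      map_add' := fun M N => by
        ext f s
        simp [add_mul, Finset.sum_add_distrib]
      map_smul' := fun a M => by
        ext f s
        simp [Finset.smul_sum] }
    (by
      apply LinearMap.ext
      intro f
      funext s
      simp only [LinearMap.coe_mk, AddHom.coe_mk, Matrix.one_apply, Module.End.one_apply]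
      rw [Finset.sum_eq_single (s i)]
      · simp
      · intro b _ hb; simp [hb.symm]
      · simp)
    (fun M N => by
      apply LinearMap.ext
      intro f
      funext s
      simp only [LinearMap.coe_mk, AddHom.coe_mk, Matrix.mul_apply, Module.End.mul_apply,
        Finset.sum_mul, Finset.mul_sum, Function.update_self, Function.update_idem]
      rw [Finset.sum_comm]
      simp only [mul_assoc])

theorem coordRep_apply {k E Q : Type} [Field k] [Field E] [Algebra k E] [Fintype Q] {p : ℕ}
    (i : Fin p) (M : Matrix Q Q E) (f : (Fin p → Q) → E) (s : Fin p → Q) :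
    coordRep k i M f s = ∑ u, M (s i) u * f (Function.update s i u) := rfl

theorem coordRep_comm {k E Q : Type} [Field k] [Field E] [Algebra k E] [Fintype Q] {p : ℕ}
    (i j : Fin p) (hij : i ≠ j) (M N : Matrix Q Q E) :
    coordRep k i M * coordRep k j N = coordRep k j N * coordRep k i M := by
  apply LinearMap.ext
  intro f
  funext s
  simp only [Module.End.mul_apply, coordRep_apply, Finset.mul_sum]
  rw [Finset.sum_comm]
  refine Finset.sum_congr rfl fun u _ => Finset.sum_congr rfl fun v _ => ?_
  rw [Function.update_of_ne hij.symm, Function.update_of_ne hij, Function.update_comm hij]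
  ring

variable {k E : Type} [Field k] [Field E] [Algebra k E] [FiniteDimensional k E]

noncomputable def invSub (k : Type) {E : Type} [Field k] [Field E] [Algebra k E]
    (p : ℕ) (z : Gal(E/k) → Gal(E/k) → k) : Submodule k ((Fin p → Gal(E/k)) → E) where
  carrier := {f | ∀ (s : Fin p → Gal(E/k)) (r : Gal(E/k)), f (fun j => s j * r) =
    (∏ j, algebraMap k E (z (s j) r)) * r⁻¹ (f s)}
  add_mem' := by
    intro f g hf hg s r
    simp only [Pi.add_apply, hf s r, hg s r, map_add, mul_add]
  zero_mem' := by
    intro s r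
    simp
  smul_mem' := by
    intro a f hf s r
    simp only [Pi.smul_apply, hf s r, map_smul, mul_smul_comm]

theorem invSub_stable (p : ℕ) (z : Gal(E/k) → Gal(E/k) → k) (i : Fin p)
    (M : crossAlg z) (f : (Fin p → Gal(E/k)) → E) (hf : f ∈ invSub k p z) :
    coordRep k i M.1 f ∈ invSub k p z := by
  intro s r
  rw [coordRep_apply, coordRep_apply, map_sum, Finset.mul_sum, ← Equiv.sum_comp (Equiv.mulRight r)]
  refine Finset.sum_congr rfl fun u _ => ?_
  simp only [Equiv.coe_mulRight, map_mul]
  have h1 : Function.update (fun j => s j * r) i (u * r) =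
      fun j => (Function.update s i u) j * r := by
    funext j
    by_cases h : j = i
    · subst h; simp
    · simp [h]
  rw [h1, hf]
  have h2 : ∏ j, algebraMap k E (z (Function.update s i u j) r) =
      algebraMap k E (z u r) * ∏ j ∈ Finset.univ.erase i, algebraMap k E (z (s j) r) := by
    rw [← Finset.mul_prod_erase _ _ (Finset.mem_univ i), Function.update_self]
    congr 1
    refine Finset.prod_congr rfl fun j hj => ?_
    rw [Function.update_of_ne (Finset.ne_of_mem_erase hj)]
  rw [h2, ← Finset.mul_prod_erase _ _ (Finset.mem_univ i)]
  have h3 := M.2 (s i) u r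
  calc _ = (algebraMap k E (z u r) * M.1 (s i * r) (u * r)) *
      (∏ j ∈ Finset.univ.erase i, algebraMap k E (z (s j) r)) *
        r⁻¹ (f (Function.update s i u)) := by ring
    _ = _ := by rw [h3]; ring

noncomputable def invRep (p : ℕ) (z : Gal(E/k) → Gal(E/k) → k) (i : Fin p) :
    crossAlg z →ₐ[k] Module.End k (invSub k p z) :=
  AlgHom.ofLinearMap
    { toFun := fun M => (coordRep k i M.1).restrict (fun f hf => invSub_stable p z i M f hf)
      map_add' := fun a b => by ext w; simp
      map_smul' := fun a b => by ext w; simp }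
    (by ext w; simp) (fun a b => by ext w; simp)

theorem invRep_comm (p : ℕ) (z : Gal(E/k) → Gal(E/k) → k) (i j : Fin p) (hij : i ≠ j)
    (M N : crossAlg z) : invRep p z i M * invRep p z j N = invRep p z j N * invRep p z i M := by
  apply LinearMap.ext
  intro w
  exact Subtype.ext (congrArg (fun f : Module.End k _ => f w.1) (coordRep_comm i j hij M.1 N.1))

theorem invSub_nontrivial (q : ℕ) (z : Gal(E/k) → Gal(E/k) → k) (hz0 : ∀ a b, z a b ≠ 0)
    (hzp : ∀ a b, z a b ^ (q + 1) = 1)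
    (hz : ∀ a b d, z a b * z (a * b) d = z b d * z a (b * d)) :
    Nontrivial (invSub k (q + 1) z) := by
  let f : (Fin (q + 1) → Gal(E/k)) → E := fun s => ∏ j, algebraMap k E (z (s j * (s 0)⁻¹) (s 0))
  have hf : f ∈ invSub k (q + 1) z := by
    intro s r
    simp only [f, ← map_prod, AlgEquiv.commutes, ← map_mul]
    congr 1
    have h1 : ∀ j, z (s j) r * z (s j * (s 0)⁻¹) (s 0) =
        z (s 0) r * z (s j * r * (s 0 * r)⁻¹) (s 0 * r) := by
      intro j
      have := hz (s j * (s 0)⁻¹) (s 0) r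
      rw [inv_mul_cancel_right] at this
      rw [mul_comm, this]
      congr 2
      group
    rw [← Finset.prod_mul_distrib, Finset.prod_congr rfl (fun j _ => h1 j),
      Finset.prod_mul_distrib]
    simp [hzp]
  refine ⟨⟨⟨f, hf⟩, 0, ?_⟩⟩
  intro h
  have h2 : f 1 = 0 := congrFun (congrArg Subtype.val h) 1
  simp only [f, Finset.prod_eq_zero_iff] at h2
  obtain ⟨j, _, hj⟩ := h2
  exact hz0 _ _ (by simpa using hj)

theorem invSub_finrank [IsGalois k E] (q : ℕ) (z : Gal(E/k) → Gal(E/k) → k) :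
    Module.finrank k (invSub k (q + 1) z) ≤ Module.finrank k E ^ (q + 1) := by
  let Φ : invSub k (q + 1) z →ₗ[k] ((Fin q → Gal(E/k)) → E) :=
    { toFun := fun f s => f.1 (Fin.cons 1 s)
      map_add' := fun _ _ => rfl
      map_smul' := fun _ _ => rfl }
  have hΦ : Function.Injective Φ := by
    rw [injective_iff_map_eq_zero]
    intro f hf
    refine Subtype.ext (funext fun s => ?_)
    have h1 := f.2 (fun j => s j * (s 0)⁻¹) (s 0)
    have h2 : (fun j => s j * (s 0)⁻¹) = Fin.cons 1 (fun j : Fin q => s j.succ * (s 0)⁻¹) := by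
      funext j
      refine Fin.cases ?_ (fun j => ?_) j <;> simp
    have h3 : f.1 (fun j => s j * (s 0)⁻¹) = 0 := by
      rw [h2]
      exact congrFun hf _
    rw [h3, map_zero, mul_zero] at h1
    simpa using h1
  have := LinearMap.finrank_le_finrank_of_injective hΦ
  refine this.trans (le_of_eq ?_)
  rw [Module.finrank_pi_fintype]
  have h4 : Fintype.card (Gal(E/k)) = Module.finrank k E := by
    rw [← Nat.card_eq_fintype_card, IsGalois.card_aut_eq_finrank]
  rw [Finset.sum_const, Finset.card_univ, Fintype.card_fun, h4, Fintype.card_fin, smul_eq_mul,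
    pow_succ]

theorem cross_split (p : ℕ) (hp : 0 < p) [IsGalois k E]
    (htors : ∀ (D : Type) [DivisionRing D] [Algebra k D] [FiniteDimensional k D]
      [Algebra.IsCentral k D],
      (∃ n : ℕ, 0 < n ∧
        Nonempty ((⨂[k] (_ : Fin p), D) ≃ₐ[k] Matrix (Fin n) (Fin n) k)) →
      Module.finrank k D = 1)
    (z : Gal(E/k) → Gal(E/k) → k) (hzp : ∀ a b, z a b ^ p = 1)
    (hz : ∀ a b d, z a b * z (a * b) d = z b d * z a (b * d)) :
    ∃ F : Gal(E/k) → Eˣ, ∀ t r, (F t : E) * t (F r) = algebraMap k E (z t r) * F (t * r) := by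
  have hz0 : ∀ a b, z a b ≠ 0 := by
    intro a b h
    have := hzp a b
    rw [h, zero_pow hp.ne'] at this
    exact zero_ne_one this
  obtain ⟨q, rfl⟩ : ∃ q, p = q + 1 := ⟨p - 1, by omega⟩
  have i1 := cross_simple z hz0 hz
  have i2 := cross_central z hz0 hz
  have i3 := invSub_nontrivial q z hz0 hzp hz
  have hfr := cross_finrank z hz0 hz
  obtain ⟨m, ⟨e⟩⟩ := csa_split (q + 1) htors (crossAlg z) (invSub k (q + 1) z)
    (invRep (q + 1) z) (fun i j hij M N => invRep_comm (q + 1) z i j hij M N) (by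
      rw [hfr, ← pow_mul, mul_comm 2, pow_mul]
      exact Nat.pow_le_pow_left (invSub_finrank q z) 2)
  have hm : m = Module.finrank k E := by
    rw [e.toLinearEquiv.finrank_eq, Module.finrank_matrix] at hfr
    simp only [Fintype.card_fin, Module.finrank_self, mul_one, ← sq] at hfr
    exact Nat.pow_left_injective (n := 2) (by norm_num) hfr
  let L : E → crossAlg z := fun x => ⟨lamM x, lamM_mem z x⟩
  let U : Gal(E/k) → crossAlg z := fun t => ⟨uM z t, uM_mem z hz t⟩
  have hUL : ∀ t x, U t * L x = L (t x) * U t := fun t x => Subtype.ext (uM_mul_lamM z t x)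
  have hUU : ∀ t r, U t * U r = z t r • U (t * r) := fun t r => Subtype.ext (uM_mul_uM z hz t r)
  have hLL : ∀ x y, L x * L y = L (x * y) := fun x y => Subtype.ext (lamM_mul x y)
  have hL1 : L 1 = 1 := Subtype.ext lamM_one
  have hmpos : 0 < m := hm ▸ Module.finrank_pos
  have : Nontrivial (Fin m → k) := by
    have : Nonempty (Fin m) := ⟨⟨0, hmpos⟩⟩
    infer_instance
  obtain ⟨v, hv⟩ := exists_ne (0 : Fin m → k)
  let act : crossAlg z →ₐ[k] Module.End k (Fin m → k) :=
    (Matrix.toLinAlgEquiv' : Matrix (Fin m) (Fin m) k ≃ₐ[k] _).toAlgHom.comp e.toAlgHom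
  let μ : E →ₗ[k] (Fin m → k) :=
    { toFun := fun x => act (L x) v
      map_add' := fun x y => by
        have : L (x + y) = L x + L y := by
          refine Subtype.ext ?_
          show lamM (x + y) = lamM x + lamM y
          simp [lamM, Matrix.diagonal_add]
        rw [this, map_add, LinearMap.add_apply]
      map_smul' := fun a x => by
        have : L (a • x) = a • L x := by
          refine Subtype.ext ?_
          show lamM (a • x) = a • lamM x
          ext s t
          simp [lamM, Matrix.diagonal_apply]
        rw [this, map_smul, LinearMap.smul_apply]; rfl }
  have hμ : ∀ x, μ x = act (L x) v := fun _ => rfl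
  have hinj : Function.Injective μ := by
    rw [injective_iff_map_eq_zero]
    intro x hx
    by_contra hx0
    apply hv
    have : act (L x⁻¹) (μ x) = v := by
      rw [hμ, ← Module.End.mul_apply, ← map_mul, hLL, inv_mul_cancel₀ hx0, hL1, map_one]; rfl
    rw [← this, hx, map_zero]
  have hsurj : Function.Surjective μ :=
    (LinearMap.injective_iff_surjective_of_finrank_eq_finrank (by simp [hm])).1 hinj
  choose F hF using fun t => hsurj (act (U t) v)
  have hrel : ∀ t r, F t * t (F r) = algebraMap k E (z t r) * F (t * r) := by
    intro t r
    apply hinj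
    have h1 : act (U t * U r) v = μ (F t * t (F r)) := by
      rw [map_mul, Module.End.mul_apply, ← hF r, hμ, ← Module.End.mul_apply, ← map_mul, hUL,
        map_mul, Module.End.mul_apply, ← hF t, hμ, ← Module.End.mul_apply, ← map_mul, hLL, mul_comm,
        hμ]
    rw [← h1, hUU, map_smul, LinearMap.smul_apply, ← hF, ← Algebra.smul_def, map_smul]
  have hF1 : F 1 ≠ 0 := by
    intro h
    have h1 := hF 1
    rw [h, map_zero] at h1
    have h2 : U 1 = z 1 1 • 1 := by
      refine Subtype.ext (cross_ext z hz0 (U 1).2 (z 1 1 • (1 : crossAlg z)).2 ?_)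
      intro s
      show (uM z 1) s 1 = (z 1 1 • (1 : Matrix (Gal(E/k)) (Gal(E/k)) E)) s 1
      by_cases hs : s = 1
      · simp [uM, hs, Algebra.smul_def]
      · simp [uM, hs]
    rw [h2, map_smul, map_one] at h1
    have h3 : z 1 1 • v = 0 := h1.symm
    exact (smul_ne_zero (hz0 1 1) hv) h3
  have hF0 : ∀ t, F t ≠ 0 := by
    intro t h
    have := hrel t t⁻¹
    rw [h, zero_mul, mul_inv_cancel] at this
    exact (mul_ne_zero (by simpa using hz0 _ _) hF1) this.symm
  exact ⟨fun t => Units.mk0 (F t) (hF0 t), hrel⟩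
end coordrep


section pgrp

/-- A system of normal subgroups with `p`-group quotients. -/
structure LvSys (p : ℕ) (G : Type) [Group G] where
  mem : Subgroup G → Prop
  normal : ∀ N, mem N → N.Normal
  inf : ∀ N M, mem N → mem M → mem (N ⊓ M)
  pow : ∀ N, mem N → ∀ g : G, ∃ n : ℕ, g ^ (p ^ n) ∈ N

/-- The second cohomology with coefficients `ZMod p` is trivial. -/
def LvSys.H2 {p : ℕ} {G : Type} [Group G] (U : LvSys p G) : Prop :=
  ∀ c : G → G → ZMod p,
    (∃ N, U.mem N ∧ ∀ g h, ∀ n ∈ N, ∀ m ∈ N, c (g * n) (h * m) = c g h) →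
    (∀ a b d, c b d + c a (b * d) = c (a * b) d + c a b) →
    ∃ f : G → ZMod p, (∃ N, U.mem N ∧ ∀ g, ∀ n ∈ N, f (g * n) = f g) ∧
      ∀ a b, c a b = f b - f (a * b) + f a

theorem exists_fixed_vec {p : ℕ} [Fact p.Prime] {G V : Type} [Group G] [AddCommGroup V]
    [Module (ZMod p) V] [Finite V] [Nontrivial V] (ρ : Representation (ZMod p) G V)
    (h : ∀ g : G, ∃ n : ℕ, ρ (g ^ (p ^ n)) = 1) : ∃ v : V, v ≠ 0 ∧ ∀ g, ρ g v = v := by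
  let σ : G →* (V ≃ₗ[ZMod p] V) := 
    (LinearMap.GeneralLinearGroup.generalLinearEquiv (ZMod p) V).toMonoidHom.comp ρ.toHomUnits
  have hσ : ∀ g v, σ g v = ρ g v := fun g v => rfl
  have hP : IsPGroup p σ.range := by
    rintro ⟨_, g, rfl⟩
    obtain ⟨n, hn⟩ := h g
    refine ⟨n, Subtype.ext ?_⟩
    ext v
    show (σ g ^ p ^ n) v = v
    rw [← map_pow, hσ, hn]; rfl
  have : Finite (V ≃ₗ[ZMod p] V) := DFunLike.finite _
  have hd : p ∣ Nat.card V := by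
    have : Module.Finite (ZMod p) V := Module.Finite.of_finite
    rw [Module.natCard_eq_pow_finrank (K := ZMod p), Nat.card_zmod]
    exact dvd_pow_self _ Module.finrank_pos.ne'
  obtain ⟨b, hb, hb0⟩ := hP.exists_fixed_point_of_prime_dvd_card_of_fixed_point V hd
    (a := (0 : V)) (by rintro ⟨s, hs⟩; show s 0 = 0; simp)
  exact ⟨b, hb0.symm, fun g => hb ⟨σ g, g, rfl⟩⟩

theorem LvSys.H2_rep {p : ℕ} [Fact p.Prime] {G : Type} [Group G] (U : LvSys p G) (hU : U.H2) :
    ∀ (d : ℕ) (V : Type) [AddCommGroup V] [Module (ZMod p) V] [Module.Finite (ZMod p) V]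
    (ρ : Representation (ZMod p) G V) (_ : ∃ N, U.mem N ∧ ∀ n ∈ N, ρ n = 1)
    (c : G → G → V) (_ : ∃ N, U.mem N ∧ ∀ g h, ∀ n ∈ N, ∀ m ∈ N, c (g * n) (h * m) = c g h)
    (_ : ∀ a b d, ρ a (c b d) + c a (b * d) = c (a * b) d + c a b),
    Module.finrank (ZMod p) V = d → 
    ∃ f : G → V, (∃ N, U.mem N ∧ ∀ g, ∀ n ∈ N, f (g * n) = f g) ∧
      ∀ a b, c a b = ρ a (f b) - f (a * b) + f a := by
  intro d
  induction d with
  | zero =>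
    intro V _ _ _ ρ ⟨N, hN, _⟩ c _ _ hd
    have : Subsingleton V := Module.finrank_zero_iff.1 hd
    exact ⟨fun _ => 0, ⟨N, hN, fun _ _ _ => rfl⟩, fun _ _ => Subsingleton.elim _ _⟩
  | succ d ih =>
    intro V _ _ _ ρ ⟨N, hN, hρN⟩ c ⟨M, hM, hcM⟩ hc hd
    have : Nontrivial V := Module.nontrivial_of_finrank_pos (R := ZMod p) (by omega)
    have : Finite V := Module.finite_of_finite (ZMod p)
    have : Finite (Module.Dual (ZMod p) V) := Module.finite_of_finite (ZMod p)
    obtain ⟨ℓ, hℓ0, hℓ⟩ := exists_fixed_vec (V := Module.Dual (ZMod p) V) ρ.dual (by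
      intro g
      obtain ⟨n, hn⟩ := U.pow N hN g
      refine ⟨n, ?_⟩
      apply LinearMap.ext; intro φ
      rw [Representation.dual_apply, hρN _ (N.inv_mem hn)]
      rfl)
    have hℓ' : ∀ g v, ℓ (ρ g v) = ℓ v := by
      intro g v
      have := LinearMap.congr_fun (hℓ g⁻¹) v
      rw [Representation.dual_apply, inv_inv] at this
      exact this
    obtain ⟨f0, ⟨N0, hN0, hf0N⟩, hf0⟩ := hU (fun a b => ℓ (c a b))
      ⟨M, hM, fun g h n hn m hm => by rw [hcM g h n hn m hm]⟩
      (fun a b d => by rw [← hℓ' a (c b d), ← map_add, hc, map_add])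
    obtain ⟨b0, hb0⟩ : ∃ b0, ℓ b0 = 1 := by
      obtain ⟨v, hv⟩ : ∃ v, ℓ v ≠ 0 := by
        by_contra hcon
        push Not at hcon
        exact hℓ0 (LinearMap.ext hcon)
      exact ⟨(ℓ v)⁻¹ • v, by rw [map_smul, smul_eq_mul, inv_mul_cancel₀ hv]⟩
    let W := LinearMap.ker ℓ
    let ρ' : Representation (ZMod p) G W :=
      { toFun := fun g => (ρ g).restrict (p := W) (q := W)
          (fun v hv => by rw [LinearMap.mem_ker] at hv ⊢; rw [hℓ', hv])
        map_one' := by ext v; simp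
        map_mul' := fun a b => by ext v; simp }
    have hρ' : ∀ g (v : W), ((ρ' g v : W) : V) = ρ g v := fun g v => rfl
    let c1 : G → G → V := fun a b => c a b - (ρ a (f0 b • b0) - f0 (a * b) • b0 + f0 a • b0)
    have hc1 : ∀ a b, c1 a b ∈ W := by
      intro a b
      simp only [W, LinearMap.mem_ker, c1, map_sub, map_add, map_smul, hℓ', hb0, smul_eq_mul,
        mul_one]
      rw [hf0]; ring
    obtain ⟨f1, ⟨N1, hN1, hf1N⟩, hf1⟩ := ih W ρ' ⟨N, hN, fun n hn => by
        ext v; rw [hρ', hρN n hn]; rfl⟩ (fun a b => ⟨c1 a b, hc1 a b⟩)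
        ⟨M ⊓ (N0 ⊓ N), U.inf _ _ hM (U.inf _ _ hN0 hN), by
          intro g h n hn m hm
          refine Subtype.ext ?_
          have hnor := U.normal N0 hN0
          have e1 : f0 (g * n * (h * m)) = f0 (g * h) := by
            have : g * n * (h * m) = (g * h) * ((h⁻¹ * n * h) * m) := by group
            rw [this]
            refine hf0N _ _ (N0.mul_mem ?_ hm.2.1)
            have := hnor.conj_mem n hn.2.1 h⁻¹
            simpa using this
          simp only [c1]
          rw [hcM g h n hn.1 m hm.1, e1, hf0N g n hn.2.1, hf0N h m hm.2.1, map_mul, hρN n hn.2.2,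
            mul_one]⟩
        (by
          intro a b d
          refine Subtype.ext ?_
          simp only [Submodule.coe_add, hρ', c1]
          have := hc a b d
          simp only [map_sub, map_add, map_mul, Module.End.mul_apply, mul_assoc]
          rw [← sub_eq_zero] at this ⊢
          rw [← this]
          abel)
        (by
          have h1 := LinearMap.finrank_range_add_finrank_ker ℓ
          have h2 : Module.finrank (ZMod p) (LinearMap.range ℓ) = 1 := by
            rw [LinearMap.range_eq_top.2, finrank_top, Module.finrank_self]
            intro t; exact ⟨t • b0, by rw [map_smul, hb0, smul_eq_mul, mul_one]⟩
          rw [h2] at h1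
          show Module.finrank (ZMod p) (LinearMap.ker ℓ) = d
          omega)
    refine ⟨fun g => (f1 g : V) + f0 g • b0, ⟨N1 ⊓ N0, U.inf _ _ hN1 hN0, fun g n hn => ?_⟩, ?_⟩
    · simp only [hf1N g n hn.1, hf0N g n hn.2]
    · intro a b
      have := congrArg Subtype.val (hf1 a b)
      simp only [Submodule.coe_add, hρ', Submodule.coe_sub, c1] at this
      rw [sub_eq_iff_eq_add] at this
      rw [this]
      simp only [map_add]
      abel

end pgrp


section shap
open scoped Classical

theorem LvSys.shapiro {p : ℕ} [Fact p.Prime] {G : Type} [Group G] (U : LvSys p G) (hU : U.H2)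
    (H : Subgroup G) [Finite (G ⧸ H)] (N0 : Subgroup G) (hN0 : U.mem N0) (hNH : N0 ≤ H)
    (c : H → H → ZMod p)
    (hcl : ∃ N, U.mem N ∧ ∀ g h n m : H, (n : G) ∈ N → (m : G) ∈ N → c (g * n) (h * m) = c g h)
    (hc : ∀ a b d, c b d + c a (b * d) = c (a * b) d + c a b) :
    ∃ f : H → ZMod p, (∃ N, U.mem N ∧ ∀ g n : H, (n : G) ∈ N → f (g * n) = f g) ∧
      ∀ a b, c a b = f b - f (a * b) + f a := by
  obtain ⟨N, hN, hcN⟩ := hcl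
  let X := G ⧸ H
  let x0 : X := ((1 : G) : G ⧸ H)
  let s : X → G := fun x => if x = x0 then 1 else x.out
  have hs : ∀ x : X, ((s x : G) : G ⧸ H) = x := by
    intro x
    by_cases hx : x = x0
    · simp only [s, hx, if_true]; rfl
    · simp only [s, hx, if_false]; exact Quotient.out_eq' x
  have hs0 : s x0 = 1 := by simp [s]
  have hmem : ∀ (g : G) (x : X), (s (g • x))⁻¹ * g * s x ∈ H := by
    intro g x
    rw [mul_assoc, ← QuotientGroup.eq, hs]
    conv_lhs => rw [← hs x]
    rfl
  let h : G → X → H := fun g x => ⟨(s (g • x))⁻¹ * g * s x, hmem g x⟩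
  have hmul : ∀ a b x, h (a * b) x = h a (b • x) * h b x := by
    intro a b x
    refine Subtype.ext ?_
    simp only [h, Subgroup.coe_mul, mul_smul]
    group
  have htriv : ∀ n ∈ N0, ∀ x : X, n • x = x := by
    intro n hn x
    rw [← hs x]
    show ((n * s x : G) : G ⧸ H) = _
    symm
    rw [QuotientGroup.eq]
    apply hNH
    have := (U.normal N0 hN0).conj_mem n hn (s x)⁻¹
    simpa [mul_assoc] using this
  have hnn : ∀ (g : G) (n : G), n ∈ N0 → n ∈ N → ∀ x : X, ∃ m : H, (m : G) ∈ N ∧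
      h (g * n) ((g * n)⁻¹ • x) = h g (g⁻¹ • x) * m := by
    intro g n hn0 hn x
    have e : (g * n)⁻¹ • x = g⁻¹ • x := by
      rw [mul_inv_rev, mul_smul, htriv _ (N0.inv_mem hn0)]
    have h1 := (U.normal N0 hN0).conj_mem n hn0 (s (g⁻¹ • x))⁻¹
    have h2 := (U.normal N hN).conj_mem n hn (s (g⁻¹ • x))⁻¹
    refine ⟨⟨_, hNH h1⟩, h2, Subtype.ext ?_⟩
    rw [e]
    simp only [h, Subgroup.coe_mul, mul_smul, htriv n hn0]
    group
  let ρ : Representation (ZMod p) G (X → ZMod p) :=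
    { toFun := fun g => LinearMap.funLeft (ZMod p) (ZMod p) (fun x : X => g⁻¹ • x)
      map_one' := by
        apply LinearMap.ext; intro f; funext x
        simp [LinearMap.funLeft_apply]
      map_mul' := fun a b => by
        apply LinearMap.ext; intro f; funext x
        simp [LinearMap.funLeft_apply, mul_smul] }
  have hρ : ∀ g f x, ρ g f x = f (g⁻¹ • x) := fun _ _ _ => rfl
  have : Fintype X := Fintype.ofFinite X
  let C : G → G → (X → ZMod p) := fun a b x => c (h a (a⁻¹ • x)) (h b (b⁻¹ • a⁻¹ • x))
  obtain ⟨f, ⟨M, hM, hfM⟩, hf⟩ := U.H2_rep hU _ (X → ZMod p) ρ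
    ⟨N0, hN0, fun n hn => by
      apply LinearMap.ext; intro f; funext x
      rw [hρ, htriv _ (N0.inv_mem hn)]; rfl⟩ C
    ⟨N0 ⊓ N, U.inf _ _ hN0 hN, by
      intro a b n hn m hm
      funext x
      obtain ⟨n', hn', e1⟩ := hnn a n hn.1 hn.2 x
      have e : (a * n)⁻¹ • x = a⁻¹ • x := by
        rw [mul_inv_rev, mul_smul, htriv _ (N0.inv_mem hn.1)]
      obtain ⟨m', hm', e2⟩ := hnn b m hm.1 hm.2 (a⁻¹ • x)
      simp only [C]
      rw [e1, e, e2, hcN _ _ _ _ hn' hm']⟩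
    (by
      intro a b d
      funext x
      simp only [Pi.add_apply, hρ, C]
      have e1 := hmul b d ((b * d)⁻¹ • a⁻¹ • x)
      have e2 := hmul a b ((a * b)⁻¹ • x)
      have e3 : d • (b * d)⁻¹ • a⁻¹ • x = b⁻¹ • a⁻¹ • x := by
        simp only [smul_smul]; congr 1; group
      have e4 : (b * d)⁻¹ • a⁻¹ • x = d⁻¹ • b⁻¹ • a⁻¹ • x := by
        simp only [smul_smul]; congr 1; group
      have e5 : b • (a * b)⁻¹ • x = a⁻¹ • x := by
        simp only [smul_smul]; congr 1; group
      have e6 : (a * b)⁻¹ • x = b⁻¹ • a⁻¹ • x := by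
        simp only [smul_smul]; congr 1; group
      rw [e3] at e1
      rw [e5] at e2
      rw [e1, e2, e4, e6]
      exact hc _ _ _) rfl
  have hx0 : ∀ a : H, (a : G) • x0 = x0 := by
    intro a
    show (((a : G) * 1 : G) : G ⧸ H) = _
    symm
    rw [QuotientGroup.eq]
    simp
  have hx0' : ∀ a : H, (a : G)⁻¹ • x0 = x0 := fun a => hx0 a⁻¹
  have hh0 : ∀ a : H, h a x0 = a := by
    intro a
    refine Subtype.ext ?_
    simp [h, hx0, hs0]
  refine ⟨fun a => f a x0, ⟨M, hM, fun g n hn => ?_⟩, ?_⟩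
  · show f ((g : G) * n) x0 = f g x0
    rw [hfM _ _ hn]
  · intro a b
    have := congrFun (hf a b) x0
    simp only [C, Pi.add_apply, Pi.sub_apply, hρ, hx0', hh0] at this
    exact this
end shap


section fieldpart
open scoped IntermediateField

theorem zv_add {p : ℕ} [Fact p.Prime] {R : Type} [CommRing R] {ζ : R} (h : ζ ^ p = 1)
    (a b : ZMod p) : ζ ^ (a + b).val = ζ ^ a.val * ζ ^ b.val := by
  rw [ZMod.val_add, ← pow_eq_pow_mod _ h, pow_add]

theorem zv_inj {p : ℕ} [Fact p.Prime] {R : Type} [CommRing R] {ζ : R} (h : IsPrimitiveRoot ζ p)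
    {a b : ZMod p} (hab : ζ ^ a.val = ζ ^ b.val) : a = b :=
  ZMod.val_injective p (h.pow_inj (ZMod.val_lt a) (ZMod.val_lt b) hab)

theorem zv_surj {p : ℕ} [Fact p.Prime] {R : Type} [CommRing R] [IsDomain R] {ζ : R}
    (h : IsPrimitiveRoot ζ p) {w : R} (hw : w ^ p = 1) : ∃ a : ZMod p, ζ ^ a.val = w := by
  obtain ⟨i, hi, rfl⟩ := h.eq_pow_of_pow_eq_one hw
  exact ⟨(i : ZMod p), by rw [ZMod.val_natCast, Nat.mod_eq_of_lt hi]⟩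

theorem h90 {k E : Type} [Field k] [Field E] [Algebra k E] [FiniteDimensional k E]
    (f : Gal(E/k) → Eˣ) (hf : ∀ g h, (f (g * h) : E) = g (f h : E) * f g) :
    ∃ b : Eˣ, ∀ g : Gal(E/k), g (b : E) = f g * b := by
  obtain ⟨b, hb⟩ := groupCohomology.isMulCoboundary₁_of_isMulCocycle₁_of_aut_to_units
    (K := k) (L := E) f (fun g h => Units.ext (hf g h))
  refine ⟨b, fun g => ?_⟩
  exact congrArg Units.val (div_eq_iff_eq_mul.1 (hb g))

variable {p : ℕ} [Fact p.Prime] {k Ω : Type} [Field k] [Field Ω] [Algebra k Ω]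

theorem exists_level [IsGalois k Ω] (x : Ω) :
    ∃ M : IntermediateField k Ω, FiniteDimensional k M ∧ Normal k M ∧ x ∈ M := by
  have hx : IsIntegral k x := Algebra.IsIntegral.isIntegral x
  have : FiniteDimensional k k⟮x⟯ := IntermediateField.adjoin.finiteDimensional hx
  refine ⟨IntermediateField.normalClosure k k⟮x⟯ Ω, inferInstance, inferInstance, ?_⟩
  exact IntermediateField.le_normalClosure _ (IntermediateField.mem_adjoin_simple_self k x)

theorem exists_level_field [IsGalois k Ω] (F : IntermediateField k Ω) [FiniteDimensional k F] :
    ∃ M : IntermediateField k Ω, FiniteDimensional k M ∧ Normal k M ∧ F ≤ M :=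
  ⟨IntermediateField.normalClosure k F Ω, inferInstance, inferInstance,
    IntermediateField.le_normalClosure _⟩

theorem fix_normal (M : IntermediateField k Ω) [Normal k M] : M.fixingSubgroup.Normal := by
  rw [← IntermediateField.restrictNormalHom_ker]; infer_instance

/-- The system of normal subgroups attached to finite normal extensions. -/
def galSys [IsGalois k Ω]
    (hprop : ∀ K : IntermediateField k Ω, FiniteDimensional k K →
      ∃ n : ℕ, Module.finrank k K = p ^ n) : LvSys p Gal(Ω/k) where
  mem N := ∃ M : IntermediateField k Ω, FiniteDimensional k M ∧ Normal k M ∧ N = M.fixingSubgroup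
  normal := by
    rintro N ⟨M, _, _, rfl⟩
    exact fix_normal M
  inf := by
    rintro N N' ⟨M, _, _, rfl⟩ ⟨M', _, _, rfl⟩
    exact ⟨M ⊔ M', inferInstance, inferInstance, IntermediateField.fixingSubgroup_sup.symm⟩
  pow := by
    rintro N ⟨M, _, _, rfl⟩ g
    obtain ⟨n, hn⟩ := hprop M inferInstance
    refine ⟨n, ?_⟩
    have : IsGalois k M := ⟨⟩
    rw [← IntermediateField.restrictNormalHom_ker, MonoidHom.mem_ker, map_pow, ← hn,
      ← IsGalois.card_aut_eq_finrank k M]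
    exact pow_card_eq_one'

theorem exists_zeta [IsAlgClosed Ω] [IsGalois k Ω] (hchar : ringChar k ≠ p)
    (hprop : ∀ K : IntermediateField k Ω, FiniteDimensional k K →
      ∃ n : ℕ, Module.finrank k K = p ^ n) : ∃ ζ : k, IsPrimitiveRoot ζ p := by
  have hp : p.Prime := Fact.out
  have hpk : (p : k) ≠ 0 := by
    intro h
    rw [ringChar.spec] at h
    rcases (Nat.dvd_prime hp).1 h with h1 | h1
    · exact (CharP.ringChar_ne_one (R := k)) h1
    · exact hchar h1
  have hpΩ : (p : Ω) ≠ 0 := by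
    rw [← map_natCast (algebraMap k Ω)]
    exact (map_ne_zero _).2 hpk
  have : NeZero (p : Ω) := ⟨hpΩ⟩
  obtain ⟨x, hx⟩ := IsAlgClosed.exists_root (Polynomial.cyclotomic p Ω)
    (Polynomial.degree_cyclotomic_pos p Ω hp.pos).ne'
  have hxp := Polynomial.isRoot_cyclotomic_iff.1 hx
  have hi : IsIntegral k x := Algebra.IsIntegral.isIntegral x
  have : FiniteDimensional k k⟮x⟯ := IntermediateField.adjoin.finiteDimensional hi
  obtain ⟨n, hn⟩ := hprop k⟮x⟯ inferInstance
  have h1 := hn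
  rw [IntermediateField.adjoin.finrank hi] at h1
  have h2 : (minpoly k x).natDegree ≤ p - 1 := by
    rw [← Nat.totient_prime hp, ← Polynomial.natDegree_cyclotomic p k]
    refine Polynomial.natDegree_le_of_dvd (minpoly.dvd k x ?_) (Polynomial.cyclotomic_ne_zero p k)
    rw [Polynomial.aeval_def, ← Polynomial.eval_map, Polynomial.map_cyclotomic]
    exact hx
  have hn0 : n = 0 := by
    by_contra h0
    have := Nat.le_self_pow h0 p
    have := hp.pos
    omega
  rw [hn0, pow_zero, IntermediateField.finrank_eq_one_iff, IntermediateField.adjoin_simple_eq_bot_iff,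
    IntermediateField.mem_bot] at hn
  obtain ⟨ζ, rfl⟩ := hn
  exact ⟨ζ, hxp.of_map_of_injective (algebraMap k Ω).injective⟩

theorem gal_H2 [IsAlgClosed Ω] [IsGalois k Ω] 
    (hprop : ∀ K : IntermediateField k Ω, FiniteDimensional k K →
      ∃ n : ℕ, Module.finrank k K = p ^ n)
    (htors : ∀ (D : Type) [DivisionRing D] [Algebra k D] [FiniteDimensional k D]
      [Algebra.IsCentral k D],
      (∃ n : ℕ, 0 < n ∧
        Nonempty ((⨂[k] (_ : Fin p), D) ≃ₐ[k] Matrix (Fin n) (Fin n) k)) →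
      Module.finrank k D = 1) {ζ : k} (hζ : IsPrimitiveRoot ζ p) : (galSys hprop).H2 := by
  have hp : p.Prime := Fact.out
  rintro c ⟨_, ⟨E, hfd, hnor, rfl⟩, hcE⟩ hc
  have : IsGalois k E := ⟨⟩
  let π : Gal(Ω/k) →* Gal(E/k) := AlgEquiv.restrictNormalHom E
  have hπ : ∀ g (x : E), ((π g x : E) : Ω) = g x := fun g x => AlgEquiv.restrictNormal_commutes g E x
  have hsur : Function.Surjective π := AlgEquiv.restrictNormalHom_surjective (F := k) (K₁ := E) Ω
  choose sec hsec using hsur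
  have hker : ∀ g g', π g = π g' → ∃ n ∈ E.fixingSubgroup, g' = g * n := by
    intro g g' h
    refine ⟨g⁻¹ * g', ?_, by group⟩
    rw [← IntermediateField.restrictNormalHom_ker, MonoidHom.mem_ker]
    show π (g⁻¹ * g') = 1
    rw [map_mul, map_inv, h, inv_mul_cancel]
  have hcc : ∀ g g' h h', π g = π g' → π h = π h' → c g' h' = c g h := by
    intro g g' h h' e1 e2
    obtain ⟨n, hn, rfl⟩ := hker g g' e1
    obtain ⟨m, hm, rfl⟩ := hker h h' e2
    exact hcE g h n hn m hm
  obtain ⟨F, hF⟩ := cross_split (k := k) (E := E) p hp.pos htors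
    (fun t r => ζ ^ (c (sec t) (sec r)).val)
    (fun t r => by rw [← pow_mul, mul_comm, pow_mul, hζ.pow_eq_one, one_pow])
    (fun t r s => by
      rw [← zv_add hζ.pow_eq_one, ← zv_add hζ.pow_eq_one]
      congr 2
      have := hc (sec t) (sec r) (sec s)
      rw [hcc (sec (t * r)) (sec t * sec r) (sec s) (sec s) (by simp [hsec]) rfl,
        hcc (sec t) (sec t) (sec (r * s)) (sec r * sec s) rfl (by simp [hsec])] at this
      rw [this, add_comm])
  have hFg : ∀ a b, ((F (π a) : E) : Ω) * a (F (π b) : E) =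
      algebraMap k Ω (ζ ^ (c a b).val) * (F (π (a * b)) : E) := by
    intro a b
    have := congrArg (algebraMap E Ω) (hF (π a) (π b))
    rw [map_mul, map_mul, ← IsScalarTower.algebraMap_apply, ← map_mul π] at this
    rw [hcc a (sec (π a)) b (sec (π b)) (by simp [hsec]) (by simp [hsec])] at this
    rw [← hπ]
    exact this
  obtain ⟨b, hb⟩ := h90 (k := k) (E := E) (fun t => F t ^ p) (by
      intro t r
      have := congrArg (fun x => x ^ p) (hF t r)
      simp only [mul_pow, ← map_pow] at this
      rw [← pow_mul, mul_comm _ p, pow_mul, hζ.pow_eq_one, one_pow, map_one, one_mul] at this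
      simp only [Units.val_pow_eq_pow_val]
      rw [← this, mul_comm])
  have hb' : ∀ g : Gal(Ω/k), g ((b : E) : Ω) = ((F (π g) : E) : Ω) ^ p * ((b : E) : Ω) := by
    intro g
    rw [← hπ, hb]
    rfl
  obtain ⟨β, hβ⟩ := IsAlgClosed.exists_pow_nat_eq ((b : E) : Ω) hp.pos
  have hb0 : ((b : E) : Ω) ≠ 0 := by
    simpa using b.ne_zero
  have hβ0 : β ≠ 0 := by
    rintro rfl
    rw [zero_pow hp.ne_zero] at hβ
    exact hb0 hβ.symm
  have hgβ : ∀ g : Gal(Ω/k), g β ≠ 0 := fun g => by simpa using hβ0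
  let F' : Gal(Ω/k) → Ω := fun g => ((F (π g) : E) : Ω) * β / g β
  have hF'p : ∀ g, F' g ^ p = 1 := by
    intro g
    simp only [F']
    rw [div_pow, mul_pow, ← map_pow, hβ, hb', div_self]
    refine mul_ne_zero (pow_ne_zero _ ?_) hb0
    simpa using (F (π g)).ne_zero
  have hζΩ : IsPrimitiveRoot (algebraMap k Ω ζ) p := hζ.map_of_injective (algebraMap k Ω).injective
  choose f hf using fun g => zv_surj hζΩ (hF'p g)
  obtain ⟨M, hM1, hM2, hM3⟩ := exists_level (k := k) β
  refine ⟨f, ⟨E.fixingSubgroup ⊓ M.fixingSubgroup, (galSys hprop).inf _ _ ⟨E, hfd, hnor, rfl⟩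
    ⟨M, hM1, hM2, rfl⟩, ?_⟩, ?_⟩
  · intro g n hn
    apply zv_inj hζΩ
    rw [hf, hf]
    simp only [F']
    have h1 : π n = 1 := by
      have := hn.1
      rw [← IntermediateField.restrictNormalHom_ker] at this
      exact this
    have h2 : n β = β := (IntermediateField.mem_fixingSubgroup_iff _ _).1 hn.2 β hM3
    rw [map_mul, h1, mul_one, AlgEquiv.mul_apply, h2]
  · intro a b
    have key : F' a * F' b = algebraMap k Ω (ζ ^ (c a b).val) * F' (a * b) := by
      have e1 : F' b = a (F' b) := by
        rw [← hf b, ← map_pow, AlgEquiv.commutes]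
      rw [e1]
      simp only [F', map_div₀, map_mul a]
      rw [AlgEquiv.mul_apply]
      have := hFg a b
      have h1 := hgβ a
      have h2 : a (b β) ≠ 0 := by simpa using hβ0
      field_simp
      linear_combination this
    rw [← hf, ← hf, ← hf, map_pow, ← zv_add hζΩ.pow_eq_one, ← zv_add hζΩ.pow_eq_one] at key
    have := zv_inj hζΩ key
    linear_combination -this
end fieldpart


section transfer
open scoped IntermediateField

variable {p : ℕ} [Fact p.Prime] {k Ω : Type} [Field k] [Field Ω] [Algebra k Ω]

theorem hprop_up (hprop : ∀ K : IntermediateField k Ω, FiniteDimensional k K →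
      ∃ n : ℕ, Module.finrank k K = p ^ n) (K : IntermediateField k Ω) [FiniteDimensional k K] :
    ∀ L : IntermediateField K Ω, FiniteDimensional K L → ∃ n : ℕ, Module.finrank K L = p ^ n := by
  intro L hL
  have : FiniteDimensional k (L.restrictScalars k) := Module.Finite.trans (R := k) K L
  obtain ⟨n, hn⟩ := hprop (L.restrictScalars k) inferInstance
  have : Module.Free K L := Module.Free.of_divisionRing K L
  have h1 : Module.finrank k K * Module.finrank K L = Module.finrank k (L.restrictScalars k) :=
    Module.finrank_mul_finrank k K L
  rw [hn] at h1
  obtain ⟨m, _, hm⟩ := (Nat.dvd_prime_pow Fact.out).1 (Dvd.intro_left _ h1)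
  exact ⟨m, hm⟩

theorem level_up [IsGalois k Ω] (K : IntermediateField k Ω) (M' : IntermediateField k Ω)
    [FiniteDimensional k M'] :
    ∃ M : IntermediateField K Ω, FiniteDimensional K M ∧ Normal K M ∧ ∀ y ∈ M', y ∈ M := by
  obtain ⟨x, hx⟩ := Field.exists_primitive_element k M'
  obtain ⟨M, h1, h2, h3⟩ := exists_level (k := K) (x : Ω)
  refine ⟨M, h1, h2, fun y hy => ?_⟩
  have h4 : M' ≤ M.restrictScalars k := by
    have : M' = k⟮(x : Ω)⟯ := by
      have := congrArg IntermediateField.lift hx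
      rw [IntermediateField.lift_adjoin_simple, IntermediateField.lift_top] at this
      exact this.symm
    rw [this, IntermediateField.adjoin_simple_le_iff]
    exact h3
  exact h4 hy

theorem H2_up [IsGalois k Ω] (hprop : ∀ K : IntermediateField k Ω, FiniteDimensional k K →
      ∃ n : ℕ, Module.finrank k K = p ^ n) (hH : (galSys hprop).H2)
    (K : IntermediateField k Ω) [FiniteDimensional k K]
    (hprop' : ∀ L : IntermediateField K Ω, FiniteDimensional K L →
      ∃ n : ℕ, Module.finrank K L = p ^ n) : (galSys hprop').H2 := by
  rintro c ⟨_, ⟨E, hfd, hnor, rfl⟩, hcE⟩ hc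
  obtain ⟨M0, hM0, hM0', hKM⟩ := exists_level_field K
  have hle : M0.fixingSubgroup ≤ K.fixingSubgroup := IntermediateField.fixingSubgroup_le hKM
  have hfin : Finite (Gal(Ω/k) ⧸ K.fixingSubgroup) := by
    have : M0.fixingSubgroup.FiniteIndex := by
      rw [← IntermediateField.restrictNormalHom_ker]; infer_instance
    have := Subgroup.finiteIndex_of_le hle
    infer_instance
  let e : K.fixingSubgroup ≃* Gal(Ω/K) := IntermediateField.fixingSubgroupEquiv K
  have he : ∀ g x, e g x = (g : Gal(Ω/k)) x := fun g x => rfl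
  have : FiniteDimensional k (E.restrictScalars k) := Module.Finite.trans (R := k) K E
  obtain ⟨M1, hM1, hM1', hEM⟩ := exists_level_field (E.restrictScalars k)
  obtain ⟨f, ⟨_, ⟨M2, hM2, hM2', rfl⟩, hfN⟩, hf⟩ := (galSys hprop).shapiro hH K.fixingSubgroup
    M0.fixingSubgroup ⟨M0, hM0, hM0', rfl⟩ hle (fun a b => c (e a) (e b))
    ⟨M1.fixingSubgroup, ⟨M1, hM1, hM1', rfl⟩, by
      intro g h n m hn hm
      simp only [map_mul]
      apply hcE
      · rw [IntermediateField.mem_fixingSubgroup_iff] at hn ⊢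
        exact fun x hx => hn x (hEM hx)
      · rw [IntermediateField.mem_fixingSubgroup_iff] at hm ⊢
        exact fun x hx => hm x (hEM hx)⟩
    (fun a b d => by simp only [map_mul]; exact hc _ _ _)
  obtain ⟨M, h1, h2, h3⟩ := level_up K M2
  refine ⟨fun g => f (e.symm g), ⟨M.fixingSubgroup, ⟨M, h1, h2, rfl⟩, ?_⟩, ?_⟩
  · intro g n hn
    simp only [map_mul]
    apply hfN
    rw [IntermediateField.mem_fixingSubgroup_iff] at hn ⊢
    intro x hx
    rw [← he, e.apply_symm_apply]
    exact hn x (h3 x hx)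
  · intro a b
    have := hf (e.symm a) (e.symm b)
    simpa using this

theorem kummer [IsGalois k Ω] (χ : Gal(Ω/k) → k) (h0 : ∀ g, χ g ≠ 0)
    (hχ : ∀ g h, χ (g * h) = χ g * χ h) (M : IntermediateField k Ω) [FiniteDimensional k M]
    [Normal k M] (hM : ∀ g ∈ M.fixingSubgroup, χ g = 1) :
    ∃ t : Ω, t ≠ 0 ∧ ∀ g : Gal(Ω/k), g t = algebraMap k Ω (χ g) * t := by
  let π : Gal(Ω/k) →* Gal(M/k) := AlgEquiv.restrictNormalHom M
  have hπ : ∀ g (x : M), ((π g x : M) : Ω) = g x := fun g x => AlgEquiv.restrictNormal_commutes g M x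
  have hsur : Function.Surjective π := AlgEquiv.restrictNormalHom_surjective (F := k) (K₁ := M) Ω
  choose sec hsec using hsur
  have hker : ∀ g g', π g = π g' → χ g = χ g' := by
    intro g g' h
    have h1 : g⁻¹ * g' ∈ M.fixingSubgroup := by
      rw [← IntermediateField.restrictNormalHom_ker, MonoidHom.mem_ker]
      show π (g⁻¹ * g') = 1
      rw [map_mul, map_inv, h, inv_mul_cancel]
    have : g' = g * (g⁻¹ * g') := by group
    rw [this, hχ, hM _ h1, mul_one]
  obtain ⟨b, hb⟩ := h90 (k := k) (E := M)
    (fun t => Units.map (algebraMap k M).toMonoidHom (Units.mk0 (χ (sec t)) (h0 _))) (by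
      intro t r
      show algebraMap k M (χ (sec (t * r))) = t (algebraMap k M (χ (sec r))) *
        algebraMap k M (χ (sec t))
      rw [AlgEquiv.commutes, ← map_mul, hker (sec (t * r)) (sec t * sec r) (by simp [hsec]), hχ,
        mul_comm])
  refine ⟨((b : M) : Ω), by simp, fun g => ?_⟩
  have := congrArg (algebraMap M Ω) (hb (π g))
  rw [map_mul] at this
  have h2 : algebraMap k Ω (χ (sec (π g))) = algebraMap M Ω (algebraMap k M (χ (sec (π g)))) :=
    IsScalarTower.algebraMap_apply _ _ _ _
  rw [← hπ, hker g (sec (π g)) (by simp [hsec]), h2]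
  exact this

end transfer


section normthm
open scoped IntermediateField

variable {p : ℕ} [Fact p.Prime] {k Ω : Type} [Field k] [Field Ω] [Algebra k Ω]

theorem norm_surj [IsAlgClosed Ω] [IsGalois k Ω]
    (hprop : ∀ K : IntermediateField k Ω, FiniteDimensional k K →
      ∃ n : ℕ, Module.finrank k K = p ^ n) (hH : (galSys hprop).H2)
    {ζ : k} (hζ : IsPrimitiveRoot ζ p) (E : IntermediateField k Ω) [FiniteDimensional k E]
    [Normal k E] (hE : Module.finrank k E = p) (σ : Gal(E/k)) (hσ : σ ≠ 1) (a : k) (ha : a ≠ 0) :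
    ∃ y : E, y ≠ 0 ∧ ∏ j ∈ Finset.range p, (σ ^ j) y = algebraMap k E a := by
  have hp : p.Prime := Fact.out
  have : IsGalois k E := ⟨⟩
  let π : Gal(Ω/k) →* Gal(E/k) := AlgEquiv.restrictNormalHom E
  have hπ : ∀ g (x : E), ((π g x : E) : Ω) = g x := fun g x => AlgEquiv.restrictNormal_commutes g E x
  have hsur : Function.Surjective π := AlgEquiv.restrictNormalHom_surjective (F := k) (K₁ := E) Ω
  have hker : ∀ g, π g = 1 ↔ g ∈ E.fixingSubgroup := by
    intro g
    rw [← IntermediateField.restrictNormalHom_ker, MonoidHom.mem_ker]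
  obtain ⟨i, hi, hi0, hi1⟩ : ∃ i : Gal(E/k) → ZMod p, (∀ s t, i (s * t) = i s + i t) ∧
      (∀ s, i s = 0 ↔ s = 1) ∧ i σ = 1 := by
    let e : Gal(E/k) ≃* Multiplicative (ZMod p) := mulEquivOfPrimeCardEq (p := p)
      (by rw [IsGalois.card_aut_eq_finrank, hE]) (by simp)
    let i0 : Gal(E/k) → ZMod p := fun s => Multiplicative.toAdd (e s)
    have h0 : ∀ s, i0 s = 0 ↔ s = 1 := by
      intro s
      simp only [i0, toAdd_eq_zero, map_eq_one_iff e e.injective]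
    have hu : i0 σ ≠ 0 := fun h => hσ ((h0 σ).1 h)
    refine ⟨fun s => (i0 σ)⁻¹ * i0 s, fun s t => ?_, fun s => ?_, inv_mul_cancel₀ hu⟩
    · simp only [i0, map_mul, toAdd_mul, mul_add]
    · simp only [mul_eq_zero, inv_eq_zero, hu, false_or, h0]
  obtain ⟨α, hα⟩ := IsAlgClosed.exists_pow_nat_eq (algebraMap k Ω a) hp.pos
  have haΩ : algebraMap k Ω a ≠ 0 := (map_ne_zero _).2 ha
  have hα0 : α ≠ 0 := by
    rintro rfl
    rw [zero_pow hp.ne_zero] at hα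
    exact haΩ hα.symm
  have hζΩ : IsPrimitiveRoot (algebraMap k Ω ζ) p := hζ.map_of_injective (algebraMap k Ω).injective
  set z : Ω := algebraMap k Ω ζ with hz
  have hzp : z ^ p = 1 := hζΩ.pow_eq_one
  have hgz : ∀ (g : Gal(Ω/k)) (n : ℕ), g (z ^ n) = z ^ n := by
    intro g n
    rw [map_pow, hz, AlgEquiv.commutes]
  have hj' : ∀ g : Gal(Ω/k), ∃ j : ZMod p, z ^ j.val = g α / α := by
    intro g
    apply zv_surj hζΩ
    rw [div_pow, ← map_pow, hα, AlgEquiv.commutes, div_self haΩ]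
  choose j hj'' using hj'
  have hj : ∀ g : Gal(Ω/k), g α = z ^ (j g).val * α := by
    intro g
    rw [hj'', div_mul_cancel₀ _ hα0]
  have hjmul : ∀ g h, j (g * h) = j g + j h := by
    intro g h
    apply zv_inj hζΩ
    rw [zv_add hzp]
    apply mul_right_cancel₀ hα0
    rw [← hj, AlgEquiv.mul_apply, hj h, map_mul, hgz, hj g]
    ring
  obtain ⟨Mα, hMα, hMα', hαM⟩ := exists_level (k := k) α
  have hjn : ∀ n ∈ Mα.fixingSubgroup, j n = 0 := by
    intro n hn
    have h1 := hj n
    rw [(IntermediateField.mem_fixingSubgroup_iff _ _).1 hn α hαM] at h1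
    apply zv_inj hζΩ
    apply mul_right_cancel₀ hα0
    rw [← h1]; simp
  obtain ⟨f, ⟨_, ⟨L, hL, hL', rfl⟩, hfL⟩, hf⟩ := hH (fun g h => - (j g * i (π h)))
    ⟨Mα.fixingSubgroup ⊓ E.fixingSubgroup, (galSys hprop).inf _ _ ⟨Mα, hMα, hMα', rfl⟩
      ⟨E, inferInstance, inferInstance, rfl⟩, fun g h n hn m hm => by
        simp only [hjmul, hjn n hn.1, map_mul, (hker m).2 hm.2, mul_one, add_zero]⟩
    (fun a b d => by simp only [hjmul, map_mul, hi]; ring)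
  let Fc : Gal(Ω/k) → Ω := fun g => z ^ (f g).val * α ^ (i (π g)).val
  have hFc : ∀ g h, Fc g * g (Fc h) = z ^ (f (g * h)).val * α ^ ((i (π g)).val + (i (π h)).val) := by
    intro g h
    have e1 : f (g * h) = f g + f h + j g * i (π h) := by
      have := hf g h
      linear_combination this
    have e2 : z ^ (j g * i (π h)).val = (z ^ (j g).val) ^ (i (π h)).val := by
      rw [ZMod.val_mul, ← pow_eq_pow_mod _ hzp, pow_mul]
    simp only [Fc]
    rw [e1, zv_add hzp, zv_add hzp, e2, map_mul, hgz, map_pow, hj, mul_pow, pow_add]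
    ring
  have hz0 : z ≠ 0 := hζΩ.ne_zero hp.ne_zero
  obtain ⟨t, ht0, ht⟩ : ∃ t : Ω, t ≠ 0 ∧ ∀ n ∈ E.fixingSubgroup, n t = Fc n * t := by
    obtain ⟨M, h1, h2, h3⟩ := level_up E L
    have hζE : algebraMap E Ω (algebraMap k E ζ) = z := (IsScalarTower.algebraMap_apply _ _ _ _).symm
    let e : E.fixingSubgroup ≃* Gal(Ω/E) := IntermediateField.fixingSubgroupEquiv E
    have he : ∀ g x, e g x = (g : Gal(Ω/k)) x := fun g x => rfl
    have hζE0 : algebraMap k E ζ ≠ 0 := (map_ne_zero _).2 (hζ.ne_zero hp.ne_zero)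
    have hf1 : ∀ n ∈ L.fixingSubgroup, f n = 0 := by
      intro n hn
      have e1 := hfL 1 n hn
      have e2 := hf 1 1
      simp only [map_one, (hi0 1).2 rfl, mul_zero, neg_zero, one_mul] at e1 e2
      rw [e1]
      linear_combination -e2
    obtain ⟨t, ht0, ht⟩ := kummer (k := E) (Ω := Ω)
      (fun g => (algebraMap k E ζ) ^ (f (e.symm g : E.fixingSubgroup)).val)
      (fun g => pow_ne_zero _ hζE0)
      (fun g h => by
        rw [← zv_add (by rw [← map_pow, hζ.pow_eq_one, map_one])]
        congr 2
        have := hf (e.symm g : E.fixingSubgroup) (e.symm h : E.fixingSubgroup)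
        rw [(hker _).2 (e.symm h).2, (hi0 1).2 rfl, mul_zero, neg_zero] at this
        rw [map_mul, Subgroup.coe_mul]
        linear_combination this) M (by
        intro g hg
        rw [hf1, ZMod.val_zero, pow_zero]
        rw [IntermediateField.mem_fixingSubgroup_iff] at hg ⊢
        intro x hx
        rw [← he, e.apply_symm_apply]
        exact hg x (h3 x hx))
    refine ⟨t, ht0, fun n hn => ?_⟩
    have := ht (e ⟨n, hn⟩)
    rw [he, e.symm_apply_apply, map_pow, hζE] at this
    rw [this]
    simp only [Fc]
    rw [(hker _).2 hn, (hi0 1).2 rfl, ZMod.val_zero, pow_zero, mul_one]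
  have hgt : ∀ g : Gal(Ω/k), g t ≠ 0 := fun g => (map_ne_zero g).2 ht0
  let F' : Gal(Ω/k) → Ω := fun g => Fc g * t / g t
  have hF'0 : ∀ g, F' g ≠ 0 := by
    intro g
    exact div_ne_zero (mul_ne_zero (mul_ne_zero (pow_ne_zero _ hz0) (pow_ne_zero _ hα0)) ht0) (hgt g)
  have hF' : ∀ g h, F' g * g (F' h) = z ^ (f (g * h)).val *
      α ^ ((i (π g)).val + (i (π h)).val) * t / (g * h) t := by
    intro g h
    rw [← hFc]
    simp only [F', map_div₀, map_mul g, AlgEquiv.mul_apply]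
    have h1 := hgt g
    have h2 : g (h t) ≠ 0 := (map_ne_zero g).2 (hgt h)
    field_simp
  have hlt : ∀ g h, (i (π g)).val + (i (π h)).val < p → F' g * g (F' h) = F' (g * h) := by
    intro g h hlt
    rw [hF']
    simp only [F', Fc]
    rw [map_mul, hi, ZMod.val_add_of_lt hlt]
  have hge : ∀ g h, p ≤ (i (π g)).val + (i (π h)).val →
      F' g * g (F' h) = algebraMap k Ω a * F' (g * h) := by
    intro g h hge
    rw [hF']
    simp only [F', Fc]
    rw [map_mul, hi, ZMod.val_add_of_le hge, ← hα]
    have : (i (π g)).val + (i (π h)).val = p + ((i (π g)).val + (i (π h)).val - p) := by omega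
    conv_lhs => rw [this, pow_add]
    ring
  have hN1 : ∀ n ∈ E.fixingSubgroup, F' n = 1 := by
    intro n hn
    simp only [F']
    rw [← ht n hn, div_self (hgt n)]
  have hvN : ∀ n ∈ E.fixingSubgroup, (i (π n)).val = 0 := by
    intro n hn
    rw [(hker _).2 hn, (hi0 1).2 rfl, ZMod.val_zero]
  have hinv : ∀ g, ∀ n ∈ E.fixingSubgroup, n (F' g) = F' g := by
    intro g n hn
    have e1 := hlt n g (by rw [hvN n hn, zero_add]; exact ZMod.val_lt _)
    rw [hN1 n hn, one_mul] at e1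
    have hn' : g⁻¹ * n * g ∈ E.fixingSubgroup := by
      have := (fix_normal E).conj_mem n hn g⁻¹
      simpa using this
    have e2 := hlt g (g⁻¹ * n * g) (by rw [hvN _ hn', add_zero]; exact ZMod.val_lt _)
    rw [hN1 _ hn', map_one, mul_one] at e2
    rw [e1, e2]
    congr 1
    group
  have hmemE : ∀ g, F' g ∈ E := by
    intro g
    rw [← InfiniteGalois.fixedField_fixingSubgroup E]
    rw [IntermediateField.mem_fixedField_iff]
    exact hinv g
  obtain ⟨g0, hg0⟩ := hsur σ
  have hiσ : ∀ m : ℕ, i (σ ^ m) = m := by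
    intro m
    induction m with
    | zero => rw [pow_zero, (hi0 1).2 rfl, Nat.cast_zero]
    | succ m ih => rw [pow_succ, hi, ih, hi1, Nat.cast_succ]
  have hival : ∀ m : ℕ, m < p → (i (π (g0 ^ m))).val = m := by
    intro m hm
    rw [map_pow, hg0, hiσ, ZMod.val_natCast, Nat.mod_eq_of_lt hm]
  have hprod : ∀ m : ℕ, m < p → ∏ j ∈ Finset.range m, (g0 ^ j) (F' g0) = F' (g0 ^ m) := by
    intro m
    induction m with
    | zero =>
      intro _
      rw [Finset.prod_range_zero, pow_zero, hN1 1 (one_mem _)]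
    | succ m ih =>
      intro hm
      rw [Finset.prod_range_succ, ih (by omega), hlt, pow_succ]
      have := hival 1 hp.one_lt
      rw [pow_one] at this
      rw [hival m (by omega), this]
      exact hm
  refine ⟨⟨F' g0, hmemE g0⟩, ?_, ?_⟩
  · intro h
    exact hF'0 g0 (congrArg Subtype.val h)
  · apply (algebraMap E Ω).injective
    rw [map_prod, ← IsScalarTower.algebraMap_apply]
    have e0 : ∀ j : ℕ, algebraMap E Ω ((σ ^ j) ⟨F' g0, hmemE g0⟩) = (g0 ^ j) (F' g0) := by
      intro j
      rw [← hg0, ← map_pow]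
      exact hπ _ _
    rw [Finset.prod_congr rfl (fun j _ => e0 j)]
    obtain ⟨q, hq⟩ : ∃ q, p = q + 1 := ⟨p - 1, by have := hp.pos; omega⟩
    have hr : Finset.range p = Finset.range (q + 1) := by rw [hq]
    rw [hr, Finset.prod_range_succ, hprod q (by omega), hge, ← pow_succ, ← hq]
    · rw [hN1, mul_one]
      rw [← hker, map_pow, hg0, ← hi0, hiσ, ZMod.natCast_self]
    · have := hival 1 hp.one_lt
      rw [pow_one] at this
      rw [hival q (by omega), this]
      omega
end normthm


section sigma
open scoped IntermediateField

theorem exists_sigma_fin {p : ℕ} [Fact p.Prime] {k L : Type} [Field k] [Field L] [Algebra k L]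
    [FiniteDimensional k L] [IsGalois k L] {m : ℕ} (hm : Nat.card Gal(L/k) = p ^ m)
    (E : IntermediateField k L) (hE : E ≠ ⊥) : ∃ σ : Gal(E/k), orderOf σ = p := by
  have hP : IsPGroup p Gal(L/k) := IsPGroup.of_card hm
  have hnil := hP.isNilpotent
  have hlt : E.fixingSubgroup < ⊤ := by
    rw [lt_top_iff_ne_top]
    intro h
    apply hE
    rw [← IsGalois.fixedField_fixingSubgroup E, h, IsGalois.fixedField_top]
  obtain ⟨b, hb, hbA⟩ := SetLike.exists_of_lt
    (Group.normalizerCondition_of_isNilpotent E.fixingSubgroup hlt)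
  rw [Subgroup.mem_normalizer_iff] at hb
  have hbE : ∀ x ∈ E, b x ∈ E := by
    intro x hx
    rw [← IsGalois.fixedField_fixingSubgroup E, IntermediateField.mem_fixedField_iff]
    intro a ha
    have h1 := (hb (b⁻¹ * a * b)).2 (by simpa [mul_assoc] using ha)
    have h2 := (IntermediateField.mem_fixingSubgroup_iff _ _).1 h1 x hx
    have h3 : b ((b⁻¹ * a * b) x) = a (b x) := by
      rw [← AlgEquiv.mul_apply, ← AlgEquiv.mul_apply]
      congr 1
      group
    rw [← h3, h2]
  let s : E →ₐ[k] E := (b.toAlgHom.comp E.val).codRestrict E.toSubalgebra (fun x => hbE x.1 x.2)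
  let σ : Gal(E/k) := AlgEquiv.ofBijective s (Algebra.IsAlgebraic.algHom_bijective s)
  have hσ : ∀ x : E, ((σ x : E) : L) = b x := fun x => rfl
  have hσn : ∀ (n : ℕ) (x : E), (((σ ^ n) x : E) : L) = (b ^ n) x := by
    intro n
    induction n with
    | zero => intro x; rfl
    | succ n ih =>
      intro x
      rw [pow_succ', pow_succ', AlgEquiv.mul_apply, AlgEquiv.mul_apply, hσ, ih]
  have hσ1 : σ ≠ 1 := by
    intro h
    apply hbA
    rw [IntermediateField.mem_fixingSubgroup_iff]
    intro x hx
    rw [← hσ ⟨x, hx⟩, h]; rfl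
  have hσp : σ ^ (p ^ m) = 1 := by
    apply AlgEquiv.ext
    intro x
    apply Subtype.ext
    rw [hσn, ← hm, pow_card_eq_one']
    rfl
  apply exists_prime_orderOf_dvd_card'
  obtain ⟨r, _, hr⟩ := (Nat.dvd_prime_pow Fact.out).1 (orderOf_dvd_of_pow_eq_one hσp)
  have hr0 : r ≠ 0 := by
    rintro rfl
    exact hσ1 (orderOf_eq_one_iff.1 (by simpa using hr))
  exact ((dvd_pow_self p hr0).trans (hr ▸ dvd_rfl)).trans (orderOf_dvd_natCard σ)

variable {p : ℕ} [Fact p.Prime] {k Ω : Type} [Field k] [Field Ω] [Algebra k Ω]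

theorem exists_sigma [IsGalois k Ω]
    (hprop : ∀ K : IntermediateField k Ω, FiniteDimensional k K →
      ∃ n : ℕ, Module.finrank k K = p ^ n) (E : IntermediateField k Ω) [FiniteDimensional k E]
      (hE : E ≠ ⊥) : ∃ σ : Gal(E/k), orderOf σ = p := by
  obtain ⟨L, hL, hL', hEL⟩ := exists_level_field E
  have : IsGalois k L := ⟨⟩
  obtain ⟨m, hm⟩ := hprop L hL
  rw [← IsGalois.card_aut_eq_finrank] at hm
  obtain ⟨σ, hσ⟩ := exists_sigma_fin hm (IntermediateField.restrict hEL) (by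
    intro h
    apply hE
    rw [← IntermediateField.lift_restrict hEL, h, IntermediateField.lift_bot])
  let e := AlgEquiv.autCongr (IntermediateField.restrictAlgEquiv hEL).symm
  exact ⟨e σ, by rw [← hσ]; exact orderOf_injective e.toMonoidHom e.injective σ⟩

theorem exists_sigma_norm [IsAlgClosed Ω] [IsGalois k Ω]
    (hprop : ∀ K : IntermediateField k Ω, FiniteDimensional k K →
      ∃ n : ℕ, Module.finrank k K = p ^ n) (hH : (galSys hprop).H2)
    {ζ : k} (hζ : IsPrimitiveRoot ζ p)
    (E : IntermediateField k Ω) [FiniteDimensional k E] (hE : E ≠ ⊥) :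
    ∃ σ : Gal(E/k), σ ≠ 1 ∧ σ ^ p = 1 ∧ ∀ a : E, a ≠ 0 → σ a = a →
      ∃ y : E, y ≠ 0 ∧ ∏ j ∈ Finset.range p, (σ ^ j) y = a := by
  have hp : p.Prime := Fact.out
  obtain ⟨σ, hσ⟩ := exists_sigma hprop E hE
  refine ⟨σ, ?_, by rw [← hσ, pow_orderOf_eq_one], ?_⟩
  · rintro rfl
    rw [orderOf_one] at hσ
    exact hp.one_lt.ne hσ
  intro a ha0 ha
  let F0 : IntermediateField k E := IntermediateField.fixedField (Subgroup.zpowers σ)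
  have hF0 : ∀ x : E, x ∈ F0 ↔ σ x = x := by
    intro x
    rw [IntermediateField.mem_fixedField_iff]
    constructor
    · intro h; exact h σ (Subgroup.mem_zpowers σ)
    · intro h f hf
      have : Subgroup.zpowers σ ≤ MulAction.stabilizer Gal(E/k) x := by
        rw [Subgroup.zpowers_le]; exact h
      exact this hf
  let F : IntermediateField k Ω := IntermediateField.lift F0
  have hFE : F ≤ E := IntermediateField.lift_le F0
  have hFfd : FiniteDimensional k F :=
    (IntermediateField.liftAlgEquiv F0).toLinearEquiv.finiteDimensional
  let E' : IntermediateField F Ω := IntermediateField.extendScalars hFE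
  let f : F0 ≃+* F := (IntermediateField.liftAlgEquiv F0).toRingEquiv
  let g : E ≃+* E' :=
    { toFun := fun x => ⟨x.1, x.2⟩
      invFun := fun x => ⟨x.1, x.2⟩
      left_inv := fun _ => rfl
      right_inv := fun _ => rfl
      map_mul' := fun _ _ => rfl
      map_add' := fun _ _ => rfl }
  have hcomp : (algebraMap F E').comp (f : F0 →+* F) = (g : E →+* E').comp (algebraMap F0 E) := by
    ext x; rfl
  have hgal : IsGalois F0 E := IsGalois.of_fixed_field E (Subgroup.zpowers σ)
  have hgal' : IsGalois F E' := IsGalois.of_equiv_equiv hcomp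
  have hnor : Normal F E' := hgal'.to_normal
  have hrank : Module.finrank F E' = p := by
    rw [← Algebra.finrank_eq_of_equiv_equiv f g hcomp, ← hσ, ← Nat.card_zpowers]
    exact IntermediateField.finrank_fixedField_eq_card _
  have hfd : FiniteDimensional F E' := Module.finite_of_finrank_pos (by rw [hrank]; exact hp.pos)
  let σ' : Gal(E'/F) :=
    { (g.symm.trans σ.toRingEquiv).trans g with
      commutes' := by
        intro x
        have hx : (⟨x.1, hFE x.2⟩ : E) ∈ F0 := (IntermediateField.mem_lift (E := F0) ⟨x.1, hFE x.2⟩).1 x.2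
        exact congrArg g ((hF0 _).1 hx) }
  have hσ' : ∀ x : E, σ' (g x) = g (σ x) := fun x => rfl
  have hσn : ∀ (n : ℕ) (x : E), (σ' ^ n) (g x) = g ((σ ^ n) x) := by
    intro n
    induction n with
    | zero => intro x; rfl
    | succ n ih =>
      intro x
      rw [pow_succ', pow_succ', AlgEquiv.mul_apply, AlgEquiv.mul_apply, ih, hσ']
  have hσ1 : σ' ≠ 1 := by
    intro h
    have : σ = 1 := by
      apply AlgEquiv.ext
      intro x
      apply g.injective
      rw [← hσ', h]; rfl
    rw [this, orderOf_one] at hσ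
    exact hp.one_lt.ne hσ
  have haF : (a : Ω) ∈ F := (IntermediateField.mem_lift (E := F0) a).2 ((hF0 a).2 ha)
  have hprop' := hprop_up hprop F
  obtain ⟨y, hy0, hy⟩ := norm_surj (k := F) (Ω := Ω) hprop' (H2_up hprop hH F hprop')
    (ζ := algebraMap k F ζ) (hζ.map_of_injective (algebraMap k F).injective) E' hrank σ' hσ1
    ⟨a, haF⟩ (fun h => ha0 (Subtype.ext (congrArg (algebraMap F Ω) h)))
  refine ⟨g.symm y, by simpa using hy0, ?_⟩
  apply g.injective
  rw [map_prod]
  have h1 : algebraMap F E' ⟨a, haF⟩ = g a := rfl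
  rw [← h1, ← hy]
  refine Finset.prod_congr rfl fun j _ => ?_
  rw [← hσn, g.apply_symm_apply]

theorem exists_sigma_norm_abs [IsAlgClosed Ω] [IsGalois k Ω]
    (hprop : ∀ K : IntermediateField k Ω, FiniteDimensional k K →
      ∃ n : ℕ, Module.finrank k K = p ^ n) (hH : (galSys hprop).H2)
    {ζ : k} (hζ : IsPrimitiveRoot ζ p)
    (A : Type) [Field A] [Algebra k A] [FiniteDimensional k A] (hA : Module.finrank k A ≠ 1) :
    ∃ σ : Gal(A/k), σ ≠ 1 ∧ σ ^ p = 1 ∧ ∀ a : A, a ≠ 0 → σ a = a →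
      ∃ y : A, y ≠ 0 ∧ ∏ j ∈ Finset.range p, (σ ^ j) y = a := by
  let ι : A →ₐ[k] Ω := IsAlgClosed.lift
  let e : A ≃ₐ[k] ι.fieldRange := AlgEquiv.ofInjectiveField ι
  have : FiniteDimensional k ι.fieldRange := e.toLinearEquiv.finiteDimensional
  obtain ⟨σ, h1, h2, h3⟩ := exists_sigma_norm hprop hH hζ ι.fieldRange (by
    intro h
    apply hA
    rw [e.toLinearEquiv.finrank_eq, h, IntermediateField.finrank_bot])
  let E := AlgEquiv.autCongr e.symm
  have hE : ∀ s x, E s x = e.symm (s (e x)) := fun s x => rfl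
  refine ⟨E σ, ?_, ?_, ?_⟩
  · rwa [Ne, map_eq_one_iff E E.injective]
  · rw [← map_pow, h2, map_one]
  · intro a ha0 ha
    obtain ⟨y, hy0, hy⟩ := h3 (e a) (by simpa using ha0) (by
      rw [hE, AlgEquiv.symm_apply_eq] at ha
      exact ha)
    refine ⟨e.symm y, by simpa using hy0, ?_⟩
    apply e.injective
    rw [← hy, map_prod]
    refine Finset.prod_congr rfl fun j _ => ?_
    rw [← map_pow, hE, e.apply_symm_apply, e.apply_symm_apply]
end sigma


section divalg

theorem fin_of_hom {k D A : Type} [Field k] [DivisionRing D] [Algebra k D]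
    [FiniteDimensional k D] [Field A] [Algebra k A] (j : A →ₐ[k] D) : FiniteDimensional k A :=
  Module.Finite.of_injective j.toLinearMap j.toRingHom.injective

theorem exists_max_subfield {k D : Type} [Field k] [DivisionRing D] [Algebra k D]
    [FiniteDimensional k D] :
    ∃ (A : Type) (_ : Field A) (_ : Algebra k A) (_ : FiniteDimensional k A) (j : A →ₐ[k] D),
      ∀ d, (∀ a, d * j a = j a * d) → ∃ a, j a = d := by
  classical
  let P : ℕ → Prop := fun n => ∃ S : Subalgebra k D, (∀ x ∈ S, ∀ y ∈ S, x * y = y * x) ∧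
    Module.finrank k S = n
  have hP : ∃ n, P n ∧ ∀ m, P m → m ≤ n := by
    have h0 : P (Module.finrank k (⊥ : Subalgebra k D)) := by
      refine ⟨⊥, ?_, rfl⟩
      intro x hx y hy
      obtain ⟨a, rfl⟩ := Algebra.mem_bot.1 hx
      exact Algebra.commutes a y
    have hb : ∀ m, P m → m ≤ Module.finrank k D := by
      rintro m ⟨S, _, rfl⟩
      exact Submodule.finrank_le (Subalgebra.toSubmodule S)
    refine ⟨Nat.findGreatest P (Module.finrank k D), Nat.findGreatest_spec (hb _ h0) h0, ?_⟩
    intro m hm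
    exact Nat.le_findGreatest (hb m hm) hm
  obtain ⟨n, ⟨S, hS, hn⟩, hmax⟩ := hP
  letI cr : CommRing S := { (inferInstance : Ring S) with
    mul_comm := fun x y => Subtype.ext (hS x x.2 y y.2) }
  have hfield : IsField S := by
    refine ⟨⟨0, 1, zero_ne_one⟩, mul_comm, ?_⟩
    intro a ha
    have hinj : Function.Injective (LinearMap.mulLeft k (a : D) |>.restrict
        (p := Subalgebra.toSubmodule S) (q := Subalgebra.toSubmodule S)
        (fun x hx => S.mul_mem a.2 hx)) := by
      intro x y hxy
      have h1 : (a : D) * x = a * y := congrArg Subtype.val hxy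
      have h2 : (a : D) ≠ 0 := fun h => ha (Subtype.ext h)
      exact Subtype.ext (mul_left_cancel₀ h2 h1)
    have hsur := LinearMap.surjective_of_injective hinj
    obtain ⟨b, hb⟩ := hsur ⟨1, S.one_mem⟩
    exact ⟨⟨b, b.2⟩, Subtype.ext (congrArg Subtype.val hb)⟩
  letI fl : Field S := hfield.toField
  letI al : Algebra k S := RingHom.toAlgebra
    { toFun := fun r => ⟨algebraMap k D r, S.algebraMap_mem r⟩
      map_one' := Subtype.ext (map_one _)
      map_zero' := Subtype.ext (map_zero _)
      map_mul' := fun x y => Subtype.ext (map_mul _ x y)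
      map_add' := fun x y => Subtype.ext (map_add _ x y) }
  let j : S →ₐ[k] D :=
    { toFun := Subtype.val
      map_one' := rfl
      map_zero' := rfl
      map_mul' := fun _ _ => rfl
      map_add' := fun _ _ => rfl
      commutes' := fun _ => rfl }
  refine ⟨S, fl, al, fin_of_hom j, j, ?_⟩
  intro d hd
  let T : Subalgebra k D := Algebra.adjoin k (insert d (S : Set D))
  have hT : ∀ x ∈ T, ∀ y ∈ T, x * y = y * x := by
    have hc : ∀ a ∈ insert d (S : Set D), ∀ b ∈ insert d (S : Set D), a * b = b * a := by
      rintro a (rfl | ha) b (rfl | hb)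
      · rfl
      · exact hd ⟨b, hb⟩
      · exact (hd ⟨a, ha⟩).symm
      · exact hS a ha b hb
    intro x hx y hy
    have := Algebra.isMulCommutative_adjoin k hc
    exact congrArg Subtype.val (mul_comm' (⟨x, hx⟩ : T) ⟨y, hy⟩)
  have hle : S ≤ T := fun x hx => Algebra.subset_adjoin (Set.mem_insert_of_mem _ hx)
  have h1 := hmax _ ⟨T, hT, rfl⟩
  rw [← hn] at h1
  have h2 : Subalgebra.toSubmodule S = Subalgebra.toSubmodule T :=
    Submodule.eq_of_le_of_finrank_le (S₁ := Subalgebra.toSubmodule S)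
      (S₂ := Subalgebra.toSubmodule T) hle h1
  have h3 : d ∈ Subalgebra.toSubmodule T := Algebra.subset_adjoin (Set.mem_insert _ _)
  rw [← h2] at h3
  exact ⟨⟨d, h3⟩, rfl⟩

theorem skolem {k D A : Type} [Field k] [DivisionRing D] [Algebra k D]
    [Algebra.IsCentral k D] [Field A] [Algebra k A] [FiniteDimensional k A]
    [Algebra.IsSeparable k A] (j : A →ₐ[k] D) (σ : Gal(A/k)) :
    ∃ u : D, u ≠ 0 ∧ ∀ e, u * j e = j (σ e) * u := by
  classical
  let pb := Field.powerBasisOfFiniteOfSeparable k A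
  let x := pb.gen
  let f := minpoly k x
  have hx : IsIntegral k x := Algebra.IsIntegral.isIntegral x
  let Rx : Module.End k D := LinearMap.mulRight k (j x)
  let lj : A →+* Module.End k D := (Algebra.lmul k D).toRingHom.comp j.toRingHom
  have hlj : ∀ a v, lj a v = j a * v := fun a v => rfl
  have hRx : ∀ v, Rx v = v * j x := fun v => rfl
  have hRxp : ∀ (i : ℕ) v, (Rx ^ i) v = v * j x ^ i := by
    intro i v
    rw [LinearMap.pow_mulRight]; rfl
  let Φ : Polynomial A →+* Module.End k D := Polynomial.eval₂RingHom' lj Rx (by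
    intro a
    ext v
    simp [hlj, hRx, mul_assoc])
  have hΦ : ∀ q, Φ q = q.eval₂ lj Rx := fun q => rfl
  have hroot : (f.map (algebraMap k A)).IsRoot (σ x) := by
    rw [Polynomial.IsRoot.def, Polynomial.eval_map_algebraMap]
    rw [Polynomial.aeval_algHom_apply σ x f, minpoly.aeval, map_zero]
  obtain ⟨g, hg⟩ := Polynomial.dvd_iff_isRoot.2 hroot
  have hf0 : f.map (algebraMap k A) ≠ 0 :=
    (Polynomial.map_ne_zero_iff (algebraMap k A).injective).2 (minpoly.ne_zero hx)
  have hg0 : g ≠ 0 := by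
    rintro rfl
    exact hf0 (by rw [hg, mul_zero])
  have hdeg : g.natDegree < f.natDegree := by
    have := congrArg Polynomial.natDegree hg
    rw [Polynomial.natDegree_map, Polynomial.natDegree_mul (Polynomial.X_sub_C_ne_zero _) hg0,
      Polynomial.natDegree_X_sub_C] at this
    omega
  have hΦf : Φ (f.map (algebraMap k A)) = 0 := by
    ext v
    rw [hΦ, Polynomial.eval₂_map, Polynomial.eval₂_eq_sum_range, LinearMap.sum_apply]
    have h1 : Polynomial.aeval (j x) f = 0 := by
      rw [Polynomial.aeval_algHom_apply, minpoly.aeval, map_zero]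
    rw [Polynomial.aeval_eq_sum_range] at h1
    have h2 := congrArg (fun z => v * z) h1
    simp only [mul_zero, Finset.mul_sum] at h2
    rw [LinearMap.zero_apply, ← h2]
    refine Finset.sum_congr rfl fun i _ => ?_
    rw [Module.End.mul_apply, hRxp]
    simp only [RingHom.comp_apply, hlj, AlgHom.commutes]
    rw [mul_smul_comm, Algebra.smul_def]
  have hT : Φ g ≠ 0 := by
    intro h0
    rw [hΦ, Polynomial.eval₂_eq_sum_range' lj hdeg, ← Fin.sum_univ_eq_sum_range
      (fun i => lj (g.coeff i) * Rx ^ i)] at h0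
    have hb : LinearIndependent k (fun i : Fin f.natDegree => Rx ^ (i : ℕ)) := by
      apply LinearIndependent.of_comp (LinearMap.applyₗ (1 : D))
      have h1 := (linearIndependent_pow (K := k) x).map' j.toLinearMap
        (LinearMap.ker_eq_bot.2 j.toRingHom.injective)
      have h2 : (⇑(LinearMap.applyₗ (R := k) (M₂ := D) (1 : D)) ∘
          fun i : Fin f.natDegree => Rx ^ (i : ℕ)) =
          (⇑j.toLinearMap ∘ fun i : Fin f.natDegree => x ^ (i : ℕ)) := by
        ext i
        simp [hRxp]
      rw [h2]
      exact h1
    have := kl_aux (Algebra.lmul k D) (fun i : Fin f.natDegree => Rx ^ (i : ℕ)) hb (by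
      intro i d
      ext v
      simp [hRxp, mul_assoc]) Finset.univ (fun i => j (g.coeff i)) h0
    have h3 := this ⟨g.natDegree, hdeg⟩ (Finset.mem_univ _)
    exact hg0 (Polynomial.leadingCoeff_eq_zero.1 (j.toRingHom.injective (h3.trans (map_zero j).symm)))
  obtain ⟨v, hv⟩ : ∃ v, Φ g v ≠ 0 := by
    by_contra h
    push Not at h
    exact hT (LinearMap.ext h)
  have hux : Φ g v * j x = j (σ x) * Φ g v := by
    have h1 : Φ (Polynomial.X - Polynomial.C (σ x)) * Φ g = 0 := by
      rw [← map_mul, ← hg, hΦf]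
    have h2 := LinearMap.congr_fun h1 v
    rw [Module.End.mul_apply, map_sub, hΦ, hΦ, Polynomial.eval₂_X, Polynomial.eval₂_C,
      LinearMap.sub_apply, hRx, hlj] at h2
    exact sub_eq_zero.1 h2
  refine ⟨Φ g v, hv, ?_⟩
  intro e
  have he : e ∈ Algebra.adjoin k {x} := by
    rw [show Algebra.adjoin k {x} = ⊤ from pb.adjoin_gen_eq_top]; trivial
  induction he using Algebra.adjoin_induction with
  | mem y hy => rw [Set.mem_singleton_iff.1 hy]; exact hux
  | algebraMap r => simp only [AlgEquiv.commutes, AlgHom.commutes]; exact (Algebra.commutes r _).symm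
  | add a b _ _ ha hb => simp only [map_add, mul_add, add_mul, ha, hb]
  | mul a b _ _ ha hb => rw [map_mul, ← mul_assoc, ha, mul_assoc, hb, map_mul, map_mul, mul_assoc]

theorem div_trivial {p : ℕ} [Fact p.Prime] {k Ω : Type} [Field k] [Field Ω] [Algebra k Ω]
    [PerfectField k] [IsAlgClosed Ω] [IsGalois k Ω]
    (hprop : ∀ K : IntermediateField k Ω, FiniteDimensional k K →
      ∃ n : ℕ, Module.finrank k K = p ^ n) (hH : (galSys hprop).H2)
    {ζ : k} (hζ : IsPrimitiveRoot ζ p)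
    (D : Type) [DivisionRing D] [Algebra k D] [FiniteDimensional k D] [Algebra.IsCentral k D] :
    Module.finrank k D = 1 := by
  classical
  have hp : p.Prime := Fact.out
  obtain ⟨A, _, _, _, j, hj⟩ := exists_max_subfield (k := k) (D := D)
  have hji : Function.Injective j := j.toRingHom.injective
  by_cases hA : Module.finrank k A = 1
  · have hsur : Function.Surjective j := by
      intro d
      apply hj
      intro a
      have hbt : (⊥ : Subalgebra k A) = ⊤ := Subalgebra.bot_eq_top_of_finrank_eq_one hA
      have ha : a ∈ (⊥ : Subalgebra k A) := by rw [hbt]; trivial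
      obtain ⟨r, rfl⟩ := Algebra.mem_bot.1 ha
      rw [AlgHom.commutes]
      exact (Algebra.commutes r d).symm
    rw [← hA]
    exact (LinearEquiv.finrank_eq (LinearEquiv.ofBijective j.toLinearMap ⟨hji, hsur⟩)).symm
  exfalso
  obtain ⟨σ, hσ1, hσp, hσn⟩ := exists_sigma_norm_abs hprop hH hζ A hA
  obtain ⟨u, hu0, hu⟩ := skolem j σ
  have hum : ∀ (m : ℕ) e, u ^ m * j e = j ((σ ^ m) e) * u ^ m := by
    intro m
    induction m with
    | zero => intro e; simp
    | succ m ih =>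
      intro e
      rw [pow_succ, mul_assoc, hu, ← mul_assoc, ih, mul_assoc, pow_succ, AlgEquiv.mul_apply]
  obtain ⟨a, ha⟩ := hj (u ^ p) (by
    intro e
    rw [hum, hσp, AlgEquiv.one_apply])
  have ha0 : a ≠ 0 := by
    rintro rfl
    rw [map_zero] at ha
    exact pow_ne_zero p hu0 ha.symm
  have hσa : σ a = a := by
    apply hji
    have h1 := hu a
    rw [ha, ← pow_succ', pow_succ, ← ha] at h1
    exact (mul_right_cancel₀ hu0 h1).symm
  obtain ⟨y, hy0, hy⟩ := hσn a ha0 hσa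
  let w := j y⁻¹ * u
  have hwm : ∀ m : ℕ, w ^ m = j (∏ i ∈ Finset.range m, (σ ^ i) y⁻¹) * u ^ m := by
    intro m
    induction m with
    | zero => simp
    | succ m ih =>
      rw [pow_succ, ih, Finset.prod_range_succ, map_mul, pow_succ u m]
      simp only [w]
      rw [mul_assoc, ← mul_assoc (u ^ m), hum]
      simp only [mul_assoc]
  have hwp : w ^ p = 1 := by
    rw [hwm, ← ha, ← map_mul]
    have : ∏ i ∈ Finset.range p, (σ ^ i) y⁻¹ = a⁻¹ := by
      rw [← hy, ← Finset.prod_inv_distrib]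
      exact Finset.prod_congr rfl fun i _ => map_inv₀ _ _
    rw [this, inv_mul_cancel₀ ha0, map_one]
  obtain ⟨r, hr⟩ : ∃ r : k, algebraMap k D r = w := by
    have hwi : IsIntegral k w := Algebra.IsIntegral.isIntegral w
    have hirr := minpoly.irreducible hwi
    have hdvd : minpoly k w ∣ Polynomial.X ^ p - 1 := minpoly.dvd _ _ (by simp [hwp])
    rw [Polynomial.X_pow_sub_one_eq_prod hp.pos hζ,
      Prime.dvd_finsetProd_iff hirr.prime] at hdvd
    obtain ⟨z, _, hz⟩ := hdvd
    refine ⟨z, ?_⟩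
    have h1 := Polynomial.aeval_eq_zero_of_dvd_aeval_eq_zero hz (minpoly.aeval k w)
    simp at h1
    exact (sub_eq_zero.1 h1).symm
  have huw : u = j y * algebraMap k D r := by
    rw [hr]
    simp only [w]
    rw [← mul_assoc, ← map_mul, mul_inv_cancel₀ hy0, map_one, one_mul]
  apply hσ1
  ext e
  apply hji
  have h1 := hu e
  have h2 : u * j e = j e * u := by
    rw [huw, mul_assoc, Algebra.commutes, ← mul_assoc, ← mul_assoc, ← map_mul, ← map_mul, mul_comm]
  rw [h2] at h1
  exact (mul_right_cancel₀ hu0 h1).symm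

end divalg

/-- Let `k` be a perfect field whose absolute Galois group is a pro-`p`-group
(every finite extension of `k` has `p`-power degree) for a prime `p ≠ char k`. If the
`p`-torsion of `Br(k)` is trivial (every finite-dimensional central division `k`-algebra
whose `p`-th tensor power is a matrix algebra is trivial), then for every finite extension
`K/k` the Brauer group `Br(K)` is trivial (every finite-dimensional central division
`K`-algebra is trivial). -/
theorem stmt_11 (p : ℕ) [Fact p.Prime] (k : Type) [Field k] [PerfectField k]
    (hchar : ringChar k ≠ p)
    (hprop : ∀ K : IntermediateField k (AlgebraicClosure k), FiniteDimensional k K →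
      ∃ n : ℕ, Module.finrank k K = p ^ n)
    (htors : ∀ (D : Type) [DivisionRing D] [Algebra k D] [FiniteDimensional k D]
      [Algebra.IsCentral k D],
      (∃ n : ℕ, 0 < n ∧
        Nonempty ((⨂[k] (_ : Fin p), D) ≃ₐ[k] Matrix (Fin n) (Fin n) k)) →
      Module.finrank k D = 1) :
    ∀ K : IntermediateField k (AlgebraicClosure k), FiniteDimensional k K →
      ∀ (D : Type) [DivisionRing D] [Algebra K D] [FiniteDimensional K D]
        [Algebra.IsCentral K D],
        Module.finrank K D = 1 := by
  have hgal : IsGalois k (AlgebraicClosure k) := ⟨⟩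
  obtain ⟨ζ, hζ⟩ := exists_zeta hchar hprop
  have hH := gal_H2 hprop htors hζ
  intro K hK D _ _ _ _
  have hprop' := hprop_up hprop K
  have hH' := H2_up hprop hH K hprop'
  have hpf : PerfectField K := Algebra.IsAlgebraic.perfectField (K := k)
  exact div_trivial hprop' hH' (hζ.map_of_injective (algebraMap k K).injective) D
end
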